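/- arXiv:1909.06752 — 4 statements merged into one kernel-verified Lean document; each statement's English description precedes it below -/
import Mathlib

section
/- A class 𝒞 of graphs is nowhere dense if and only if for every r ∈ ℕ there exists a number ℓ = ℓ(r) such that splitter wins the simple ℓ-round radius-r splitter game on every graph G ∈ 𝒞. -/
open SimpleGraph

variable {V : Type} {W : Type}

/-- The set of vertices at distance at most `r` from `v` in `G`. -/
def ball (G : SimpleGraph V) (r : ℕ) (v : V) : Set V :=
  {u | ∃ p : G.Walk v u, p.length ≤ r}

/-- `G` has radius at most `r`. -/
def hasRadiusLE (G : SimpleGraph V) (r : ℕ) : Prop :=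
  ∃ u : V, ∀ v : V, ∃ p : G.Walk u v, p.length ≤ r

/-- `H` is a depth-`r` minor of `G`: there are pairwise disjoint branch sets of
radius at most `r`, one for each vertex of `H`, connected appropriately. -/
def IsDepthMinor (r : ℕ) (H : SimpleGraph W) (G : SimpleGraph V) : Prop :=
  ∃ φ : W → Set V,
    (∀ w : W, hasRadiusLE (G.induce (φ w)) r) ∧
    (Pairwise fun w w' => Disjoint (φ w) (φ w')) ∧
    (∀ a b : W, H.Adj a b → ∃ u ∈ φ a, ∃ v ∈ φ b, G.Adj u v)

/-- `H` is a minor of `G` (no restriction on the radius of branch sets). -/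
def IsMinorOf (H : SimpleGraph W) (G : SimpleGraph V) : Prop :=
  ∃ φ : W → Set V,
    (∀ w : W, (G.induce (φ w)).Connected) ∧
    (Pairwise fun w w' => Disjoint (φ w) (φ w')) ∧
    (∀ a b : W, H.Adj a b → ∃ u ∈ φ a, ∃ v ∈ φ b, G.Adj u v)

/-- A bundled finite graph. -/
structure FGraph : Type 1 where
  V : Type
  [fintypeV : Fintype V]
  G : SimpleGraph V

attribute [instance] FGraph.fintypeV

/-- A class of graphs is nowhere dense if for every `r` there is `m` such that
`K_m` is not a depth-`r` minor of any member. -/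
def NowhereDense (C : Set FGraph) : Prop :=
  ∀ r : ℕ, ∃ m : ℕ, ∀ G ∈ C, ¬ IsDepthMinor r (⊤ : SimpleGraph (Fin m)) G.G

/-- A class of graphs has bounded expansion if for every `r` the edge density of
depth-`r` minors of members is bounded. -/
def BoundedExpansion (C : Set FGraph) : Prop :=
  ∀ r : ℕ, ∃ d : ℝ, ∀ G ∈ C, ∀ (n : ℕ) (H : SimpleGraph (Fin n)),
    IsDepthMinor r H G.G → (H.edgeSet.ncard : ℝ) / (n : ℝ) ≤ d

/-- `H` is (isomorphic to) a subgraph of `G`. -/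
def IsSubgraphOf (H G : FGraph) : Prop :=
  ∃ f : H.V → G.V, Function.Injective f ∧ ∀ a b : H.V, H.G.Adj a b → G.G.Adj (f a) (f b)

/-- `N_r^{G-S}(v)`, the ball of radius `r` around `v` in `G - S`, as a subset of `V`. -/
def ballAvoiding (G : SimpleGraph V) (S : Set V) (r : ℕ) (v : V) : Set V :=
  {u | ∃ p : G.Walk v u, p.length ≤ r ∧ ∀ x ∈ p.support, x ∉ S}

/-- `B` is distance-`r` independent in `G - S`: distinct vertices of `B` have
distance greater than `r` in `G - S`. -/
def DistIndepIn (G : SimpleGraph V) (S : Set V) (r : ℕ) (B : Set V) : Prop :=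
  ∀ u ∈ B, ∀ v ∈ B, u ≠ v →
    ∀ p : G.Walk u v, (∀ x ∈ p.support, x ∉ S) → r < p.length

/-- Uniform quasi-wideness. -/
def UniformlyQuasiWide (C : Set FGraph) : Prop :=
  ∀ r : ℕ, ∃ s : ℕ, ∀ m : ℕ, ∃ N : ℕ, ∀ G ∈ C, ∀ A : Set G.V,
    N ≤ A.ncard → ∃ S : Set G.V, S.ncard ≤ s ∧
      ∃ B ⊆ A \ S, m ≤ B.ncard ∧ DistIndepIn G.G S r B

/-- Splitter wins the simple `ℓ`-round radius-`r` splitter game on `G`. -/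
def SplitterWins (r : ℕ) : (ℓ : ℕ) → (V : Type) → SimpleGraph V → Prop
  | 0, V, _ => IsEmpty V
  | (ℓ + 1), _, G =>
      ∀ C : G.Subgraph, hasRadiusLE C.coe r →
        ∃ w ∈ C.verts, SplitterWins r ℓ _ ((C.deleteVerts {w}).coe)

/-- Splitter wins the `ℓ`-round treedepth game on `G`. -/
def TDSplitterWins : (ℓ : ℕ) → (V : Type) → SimpleGraph V → Prop
  | 0, V, _ => IsEmpty V
  | (ℓ + 1), _, G =>
      ∀ c : G.ConnectedComponent, ∃ w ∈ c.supp,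
        TDSplitterWins ℓ _ (G.induce (c.supp \ {w}))

/-- Splitter wins the variant of the `ℓ`-round radius-`r` splitter game in which
she may delete up to `m` vertices per round. -/
def SplitterWinsSets (r m : ℕ) : (ℓ : ℕ) → (V : Type) → SimpleGraph V → Prop
  | 0, V, _ => IsEmpty V
  | (ℓ + 1), _, G =>
      ∀ C : G.Subgraph, hasRadiusLE C.coe r →
        ∃ W ⊆ C.verts, W.ncard ≤ m ∧ SplitterWinsSets r m ℓ _ ((C.deleteVerts W).coe)

/-- `le` is the ancestor order of a rooted forest: a partial order in which the
set of ancestors of any element is a chain. -/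
def IsForestOrder (le : V → V → Prop) : Prop :=
  (∀ v, le v v) ∧ (∀ u v w, le u v → le v w → le u w) ∧
  (∀ u v, le u v → le v u → u = v) ∧
  (∀ v u w, le u v → le w v → le u w ∨ le w u)

/-- `G` has treedepth at most `ℓ`: there is a rooted forest of depth at most `ℓ`
on `V(G)` such that every edge joins an ancestor-descendant pair. -/
def TreedepthLE (G : SimpleGraph V) (ℓ : ℕ) : Prop :=
  ∃ le : V → V → Prop, IsForestOrder le ∧
    (∀ u v, G.Adj u v → le u v ∨ le v u) ∧
    ∀ v, ({u | le u v}).ncard ≤ ℓ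

/-- The treedepth of `G`. -/
noncomputable def treedepth (G : SimpleGraph V) : ℕ := sInf {ℓ | TreedepthLE G ℓ}

/-- `WReach G le r v`: the set of vertices weakly `r`-reachable from `v`
with respect to the linear order `le`. -/
def WReach (G : SimpleGraph V) (le : V → V → Prop) (r : ℕ) (v : V) : Set V :=
  {u | le u v ∧ ∃ p : G.Walk u v, p.IsPath ∧ p.length ≤ r ∧
    ∀ x ∈ p.support, x ≠ u → x ≠ v → le u x ∧ u ≠ x}

/-- `WReachInf G le v`: the set of vertices weakly reachable from `v`
with respect to the linear order `le` (no bound on path length). -/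
def WReachInf (G : SimpleGraph V) (le : V → V → Prop) (v : V) : Set V :=
  {u | le u v ∧ ∃ p : G.Walk u v, p.IsPath ∧
    ∀ x ∈ p.support, x ≠ u → x ≠ v → le u x ∧ u ≠ x}

/-- The weak `r`-coloring number of `G`. -/
noncomputable def wcol (G : SimpleGraph V) (r : ℕ) : ℕ :=
  sInf {k | ∃ le : V → V → Prop, IsLinearOrder V le ∧ ∀ v, (WReach G le r v).ncard ≤ k}

/-- The coloring number of `G`: the least `k` such that some linear order has
every vertex with at most `k - 1` smaller neighbors. -/
noncomputable def coloringNumber (G : SimpleGraph V) : ℕ :=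
  sInf {k | ∃ le : V → V → Prop, IsLinearOrder V le ∧
    ∀ v, ({u | G.Adj u v ∧ le u v ∧ u ≠ v}).ncard + 1 ≤ k}

/-- `X` is an `r`-neighborhood cover of `G` with clusters of radius at most `ρ`:
each cluster induces a connected subgraph of radius at most `ρ`, and every
`r`-ball is contained in some cluster. -/
def IsNbhdCover (G : SimpleGraph V) (r ρ : ℕ) (X : Set (Set V)) : Prop :=
  (∀ C ∈ X, hasRadiusLE (G.induce C) ρ) ∧ ∀ v : V, ∃ C ∈ X, ball G r v ⊆ C

/-- The cluster `X_r[G,π,u] = {w : u ∈ WReach_r[G,π,w]}`. -/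
def XCluster (G : SimpleGraph V) (le : V → V → Prop) (r : ℕ) (u : V) : Set V :=
  {w | u ∈ WReach G le r w}

/-- The smaller endpoint of an edge. -/
def sym2Min {n : ℕ} (e : Sym2 (Fin n)) : Fin n :=
  Sym2.lift ⟨fun a b => min a b, fun _ _ => min_comm _ _⟩ e

/-- The larger endpoint of an edge. -/
def sym2Max {n : ℕ} (e : Sym2 (Fin n)) : Fin n :=
  Sym2.lift ⟨fun a b => max a b, fun _ _ => max_comm _ _⟩ e

/-- The relation generating the `r`-subdivision of `G`. -/
def SubdivRel {n : ℕ} (r : ℕ) (G : SimpleGraph (Fin n)) :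
    (Fin n ⊕ (G.edgeSet × Fin r)) → (Fin n ⊕ (G.edgeSet × Fin r)) → Prop
  | Sum.inl a, Sum.inl b => r = 0 ∧ G.Adj a b
  | Sum.inl a, Sum.inr ei => ((ei.2 : ℕ) = 0 ∧ a = sym2Min ei.1.1) ∨
      ((ei.2 : ℕ) = r - 1 ∧ a = sym2Max ei.1.1)
  | Sum.inr ei, Sum.inr ej => ei.1 = ej.1 ∧ (ei.2 : ℕ) + 1 = (ej.2 : ℕ)
  | Sum.inr _, Sum.inl _ => False

/-- The `r`-subdivision of `G`: every edge is replaced by a path with `r`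
internal vertices. -/
def Subdivision {n : ℕ} (r : ℕ) (G : SimpleGraph (Fin n)) :
    SimpleGraph ((Fin n) ⊕ (G.edgeSet × Fin r)) :=
  SimpleGraph.fromRel (SubdivRel r G)

open Classical in
/-- Ramsey's theorem for two colours. -/
theorem exists_ramsey (m t : ℕ) : ∃ N : ℕ, ∀ (α : Type) (R : α → α → Prop),
    (∀ a b, R a b → R b a) → ∀ A : Finset α, N ≤ A.card →
      (∃ K ⊆ A, K.card = m ∧ (K : Set α).Pairwise R) ∨
      (∃ I ⊆ A, I.card = t ∧ (I : Set α).Pairwise fun a b => ¬ R a b) := by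
  induction m generalizing t with
  | zero => exact ⟨0, fun α R _ A _ => Or.inl ⟨∅, by simp, by simp, by simp⟩⟩
  | succ m ihm =>
    induction t with
    | zero => exact ⟨0, fun α R _ A _ => Or.inr ⟨∅, by simp, by simp, by simp⟩⟩
    | succ t iht =>
      obtain ⟨N₁, h₁⟩ := ihm (t + 1)
      obtain ⟨N₂, h₂⟩ := iht
      refine ⟨N₁ + N₂ + 1, fun α R hR A hA => ?_⟩
      obtain ⟨a, ha⟩ : A.Nonempty := Finset.card_pos.mp (by omega)
      have hcard := Finset.card_filter_add_card_filter_not (s := A.erase a) (R a)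
      rw [Finset.card_erase_of_mem ha] at hcard
      have hsub : (A.erase a).filter (R a) ⊆ A :=
        (Finset.filter_subset _ _).trans (Finset.erase_subset _ _)
      rcases le_or_gt N₁ ((A.erase a).filter (R a)).card with h | h
      · rcases h₁ α R hR _ h with ⟨K, hKA, hK, hKR⟩ | ⟨I, hIA, hI, hIR⟩
        · have hmem : ∀ b ∈ K, b ≠ a ∧ R a b := fun b hb => by
            have := hKA hb
            simp only [Finset.mem_filter, Finset.mem_erase] at this
            exact ⟨this.1.1, this.2⟩
          refine Or.inl ⟨insert a K, Finset.insert_subset ha (hKA.trans hsub), ?_, ?_⟩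
          · rw [Finset.card_insert_of_notMem fun h => (hmem a h).1 rfl, hK]
          · rw [Finset.coe_insert]
            exact hKR.insert fun b hb _ => ⟨(hmem b hb).2, hR _ _ (hmem b hb).2⟩
        · exact Or.inr ⟨I, hIA.trans hsub, hI, hIR⟩
      · have hsub' : ((A.erase a).filter fun b => ¬ R a b) ⊆ A :=
          (Finset.filter_subset _ _).trans (Finset.erase_subset _ _)
        rcases h₂ α R hR ((A.erase a).filter fun b => ¬ R a b) (by omega) with
          ⟨K, hKA, hK, hKR⟩ | ⟨I, hIA, hI, hIR⟩
        · exact Or.inl ⟨K, hKA.trans hsub', hK, hKR⟩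
        · have hmem : ∀ b ∈ I, b ≠ a ∧ ¬ R a b := fun b hb => by
            have := hIA hb
            simp only [Finset.mem_filter, Finset.mem_erase] at this
            exact ⟨this.1.1, this.2⟩
          refine Or.inr ⟨insert a I, Finset.insert_subset ha (hIA.trans hsub'), ?_, ?_⟩
          · rw [Finset.card_insert_of_notMem fun h => (hmem a h).1 rfl, hI]
          · rw [Finset.coe_insert]
            exact hIR.insert fun b hb _ => ⟨(hmem b hb).2, fun h => (hmem b hb).2 (hR _ _ h)⟩

/-- A depth-one model of a complete graph on `K` in the bipartite graph of `R`: the branch set of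
`a ∈ K` is `a` together with the set `T a` of neighbours of `a`. -/
def IsStarModel {α β : Type} (R : α → β → Prop) (K : Finset α) (T : α → Finset β) : Prop :=
  (∀ a ∈ K, ∀ b ∈ T a, R a b) ∧
  (∀ a ∈ K, ∀ a' ∈ K, a ≠ a' → Disjoint (T a) (T a')) ∧
  ∀ a ∈ K, ∀ a' ∈ K, a ≠ a' → ∃ b, (b ∈ T a ∨ b ∈ T a') ∧ R a b ∧ R a' b

theorem IsStarModel.mono {α β : Type} {R R' : α → β → Prop} (h : ∀ a b, R a b → R' a b)
    {K : Finset α} {T : α → Finset β} (hT : IsStarModel R K T) : IsStarModel R' K T := by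
  refine ⟨fun a ha b hb => h _ _ (hT.1 a ha b hb), hT.2.1, fun a ha a' ha' hne => ?_⟩
  obtain ⟨b, hb, h₁, h₂⟩ := hT.2.2 a ha a' ha' hne
  exact ⟨b, hb, h _ _ h₁, h _ _ h₂⟩

open Classical in
theorem exists_isStarModel_of_shared (d m : ℕ) : ∃ N c : ℕ, ∀ (α β : Type) (R : α → β → Prop)
    (A : Finset α), N ≤ A.card → (∀ b, (A.filter fun a => R a b).card ≤ d) →
    (∀ a ∈ A, ∀ a' ∈ A, a ≠ a' → ∃ b, R a b ∧ R a' b) →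
    ∃ K ⊆ A, ∃ T : α → Finset β, K.card = m ∧ (K.biUnion T).card ≤ c ∧ IsStarModel R K T := by
  induction m with
  | zero =>
    exact ⟨0, 0, fun α β R A _ _ _ =>
      ⟨∅, by simp, fun _ => ∅, by simp, by simp, by simp [IsStarModel]⟩⟩
  | succ m ih =>
    obtain ⟨N, c, h⟩ := ih
    refine ⟨max N (m + c * d + 1), c + m, fun α β R A hA hd hsh => ?_⟩
    obtain ⟨K, hKA, T, hK, hc, hT₁, hT₂, hT₃⟩ := h α β R A (le_trans (le_max_left _ _) hA) hd hsh
    have hbad : (K ∪ (K.biUnion T).biUnion fun b => A.filter fun a => R a b).card < A.card := by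
      have h₁ := Finset.card_union_le K ((K.biUnion T).biUnion fun b => A.filter fun a => R a b)
      have h₂ := Finset.card_biUnion_le_card_mul (K.biUnion T)
        (fun b => A.filter fun a => R a b) d fun b _ => hd b
      have h₃ := Nat.mul_le_mul_right d hc
      have h₄ := le_trans (le_max_right _ _) hA
      omega
    obtain ⟨x, hxA, hx⟩ := Finset.exists_mem_notMem_of_card_lt_card hbad
    simp only [Finset.mem_union, Finset.mem_biUnion, Finset.mem_filter, not_or, not_exists,
      not_and, forall_exists_index, and_imp] at hx
    obtain ⟨hxK, hxT⟩ := hx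
    have hne : ∀ a ∈ K, a ≠ x := fun a ha h => hxK (h ▸ ha)
    choose f hf using fun (a : α) (ha : a ∈ K) => hsh a (hKA ha) x hxA (hne a ha)
    let B : Finset β := K.attach.image fun a => f a.1 a.2
    have hfB : ∀ a (ha : a ∈ K), f a ha ∈ B := fun a ha =>
      Finset.mem_image.mpr ⟨⟨a, ha⟩, Finset.mem_attach _ _, rfl⟩
    have hBx : ∀ b ∈ B, R x b := fun b hb => by
      obtain ⟨a, -, rfl⟩ := Finset.mem_image.mp hb
      exact (hf a.1 a.2).2
    have hBm : B.card ≤ m := Finset.card_image_le.trans (by rw [Finset.card_attach, hK])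
    have hdisj : ∀ a ∈ K, Disjoint (T a) B := fun a ha =>
      Finset.disjoint_left.mpr fun b hb hb' => hxT b a ha hb hxA (hBx b hb')
    have hTa : ∀ a ∈ K, Function.update T x B a = T a := fun a ha =>
      Function.update_of_ne (hne a ha) _ _
    have hTx : Function.update T x B x = B := Function.update_self _ _ _
    refine ⟨insert x K, Finset.insert_subset hxA hKA, Function.update T x B, ?_, ?_, ?_, ?_, ?_⟩
    · rw [Finset.card_insert_of_notMem hxK, hK]
    · rw [Finset.biUnion_insert, hTx, Finset.biUnion_congr rfl hTa]
      exact (Finset.card_union_le _ _).trans (by omega)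
    · refine Finset.forall_mem_insert _ _ _ |>.mpr ⟨?_, fun a ha => ?_⟩
      · rw [hTx]; exact hBx
      · rw [hTa a ha]; exact hT₁ a ha
    · refine Finset.forall_mem_insert _ _ _ |>.mpr ⟨?_, fun a ha => ?_⟩ <;>
        refine Finset.forall_mem_insert _ _ _ |>.mpr ⟨fun h => ?_, fun a' ha' h => ?_⟩
      · exact absurd rfl h
      · rw [hTx, hTa a' ha']; exact (hdisj a' ha').symm
      · rw [hTx, hTa a ha]; exact hdisj a ha
      · rw [hTa a ha, hTa a' ha']; exact hT₂ a ha a' ha' h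
    · refine Finset.forall_mem_insert _ _ _ |>.mpr ⟨?_, fun a ha => ?_⟩ <;>
        refine Finset.forall_mem_insert _ _ _ |>.mpr ⟨fun h => ?_, fun a' ha' h => ?_⟩
      · exact absurd rfl h
      · rw [hTx]; exact ⟨f a' ha', Or.inl (hfB a' ha'), (hf a' ha').symm⟩
      · rw [hTx]; exact ⟨f a ha, Or.inr (hfB a ha), hf a ha⟩
      · rw [hTa a ha, hTa a' ha']; exact hT₃ a ha a' ha' h

open Classical in
/-- If every `b` has few neighbours, then a large set contains either many elements without common
neighbours or a star model of a large complete graph. -/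
theorem exists_unshared_or_isStarModel_of_degree_le (m t d : ℕ) : ∃ N : ℕ, ∀ (α β : Type)
    (R : α → β → Prop) (A : Finset α), N ≤ A.card →
    (∀ b, (A.filter fun a => R a b).card ≤ d) →
    (∃ I ⊆ A, I.card = t ∧ ∀ a ∈ I, ∀ a' ∈ I, a ≠ a' → ∀ b, R a b → ¬ R a' b) ∨
    ∃ K ⊆ A, ∃ T : α → Finset β, K.card = m ∧ IsStarModel R K T := by
  obtain ⟨M, c, hM⟩ := exists_isStarModel_of_shared d m
  obtain ⟨N, hN⟩ := exists_ramsey M t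
  refine ⟨N, fun α β R A hA hd => ?_⟩
  rcases hN α (fun a a' => ∃ b, R a b ∧ R a' b) (fun a a' ⟨b, h⟩ => ⟨b, h.symm⟩) A hA with
    ⟨K, hKA, hK, hKR⟩ | ⟨I, hIA, hI, hIR⟩
  · obtain ⟨K', hK', T, hm, -, hT⟩ := hM α β R K hK.ge
      (fun b => (Finset.card_le_card (Finset.filter_subset_filter _ hKA)).trans (hd b))
      fun a ha a' ha' h => hKR ha ha' h
    exact Or.inr ⟨K', hK'.trans hKA, T, hm, hT⟩
  · exact Or.inl ⟨I, hIA, hI, fun a ha a' ha' h b hb hb' => hIR ha ha' h ⟨b, hb, hb'⟩⟩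

open Classical in
theorem exists_unshared_or_isStarModel_or_complete (p m t : ℕ) (hm : 0 < m) : ∃ N : ℕ,
    ∀ (α β : Type) (R : α → β → Prop) (A : Finset α), N ≤ A.card →
    (∃ W : Finset β, W.card ≤ p ∧ ∃ I ⊆ A, I.card = t ∧
      ∀ a ∈ I, ∀ a' ∈ I, a ≠ a' → ∀ b, R a b → R a' b → b ∈ W) ∨
    (∃ K ⊆ A, ∃ T : α → Finset β, K.card = m ∧ IsStarModel R K T) ∨
    ∃ W : Finset β, W.card = p ∧ ∃ K ⊆ A, K.card = m ∧ ∀ a ∈ K, ∀ b ∈ W, R a b := by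
  induction p with
  | zero =>
    refine ⟨m, fun α β R A hA => Or.inr (Or.inr ⟨∅, rfl, ?_⟩)⟩
    obtain ⟨K, hK, hc⟩ := Finset.exists_subset_card_eq hA
    exact ⟨K, hK, hc, by simp⟩
  | succ p ih =>
    obtain ⟨N₁, h₁⟩ := ih
    obtain ⟨N₂, h₂⟩ := exists_unshared_or_isStarModel_of_degree_le m t N₁
    refine ⟨N₂, fun α β R A hA => ?_⟩
    by_cases hd : ∀ b, (A.filter fun a => R a b).card ≤ N₁
    · rcases h₂ α β R A hA hd with ⟨I, hIA, hI, h⟩ | h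
      · exact Or.inl ⟨∅, by simp, I, hIA, hI, fun a ha a' ha' hne b hb hb' =>
          absurd hb' (h a ha a' ha' hne b hb)⟩
      · exact Or.inr (Or.inl h)
    · push Not at hd
      obtain ⟨w, hw⟩ := hd
      have hsub : (A.filter fun a => R a w) ⊆ A := Finset.filter_subset _ _
      rcases h₁ α β (fun a b => R a b ∧ b ≠ w) _ hw.le with
        ⟨W, hW, I, hIA, hI, h⟩ | ⟨K, hKA, T, hK, hT⟩ | ⟨W, hW, K, hKA, hK, h⟩
      · refine Or.inl ⟨insert w W, (Finset.card_insert_le _ _).trans (by omega), I,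
          hIA.trans hsub, hI, fun a ha a' ha' hne b hb hb' => ?_⟩
        by_cases hbw : b = w
        · exact hbw ▸ Finset.mem_insert_self _ _
        · exact Finset.mem_insert_of_mem (h a ha a' ha' hne b ⟨hb, hbw⟩ ⟨hb', hbw⟩)
      · exact Or.inr (Or.inl ⟨K, hKA.trans hsub, T, hK, hT.mono fun _ _ h => h.1⟩)
      · obtain ⟨x, hx⟩ : K.Nonempty := Finset.card_pos.mp (hK ▸ hm)
        have hwW : w ∉ W := fun hwW => (h x hx w hwW).2 rfl
        refine Or.inr (Or.inr ⟨insert w W, by rw [Finset.card_insert_of_notMem hwW, hW], K,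
          hKA.trans hsub, hK, fun a ha => ?_⟩)
        refine Finset.forall_mem_insert _ _ _ |>.mpr ⟨?_, fun b hb => (h a ha b hb).1⟩
        exact (Finset.mem_filter.mp (hKA ha)).2

/-- A large set contains either many elements whose common neighbours lie in a set of bounded size,
or a star model of a large complete graph. -/
theorem exists_unshared_or_isStarModel (m t : ℕ) : ∃ N : ℕ,
    ∀ (α β : Type) (R : α → β → Prop) (A : Finset α), N ≤ A.card →
    (∃ W : Finset β, W.card ≤ m ∧ ∃ I ⊆ A, I.card = t ∧
      ∀ a ∈ I, ∀ a' ∈ I, a ≠ a' → ∀ b, R a b → R a' b → b ∈ W) ∨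
    ∃ K ⊆ A, ∃ T : α → Finset β, K.card = m ∧ IsStarModel R K T := by
  classical
  rcases Nat.eq_zero_or_pos m with rfl | hm
  · exact ⟨0, fun α β R A _ => Or.inr ⟨∅, by simp, fun _ => ∅, rfl, by simp [IsStarModel]⟩⟩
  obtain ⟨N, hN⟩ := exists_unshared_or_isStarModel_or_complete m m t hm
  refine ⟨N, fun α β R A hA => ?_⟩
  rcases hN α β R A hA with h | h | ⟨W, hW, K, hKA, hK, h⟩
  · exact Or.inl h
  · exact Or.inr h
  · obtain ⟨e⟩ : Nonempty (K ≃ W) := ⟨Finset.equivOfCardEq (hK.trans hW.symm)⟩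
    obtain ⟨T, hT⟩ : ∃ T : α → Finset β, ∀ a (ha : a ∈ K), T a = {(e ⟨a, ha⟩).1} :=
      ⟨fun a => if ha : a ∈ K then {(e ⟨a, ha⟩).1} else ∅, fun a ha => dif_pos ha⟩
    refine Or.inr ⟨K, hKA, T, hK, ?_, ?_, ?_⟩
    · intro a ha b hb
      rw [hT a ha, Finset.mem_singleton] at hb
      exact hb ▸ h a ha _ (e ⟨a, ha⟩).2
    · intro a ha a' ha' hne
      rw [hT a ha, hT a' ha', Finset.disjoint_singleton]
      exact fun h => hne (congrArg Subtype.val (e.injective (Subtype.ext h)))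
    · intro a ha a' ha' _
      refine ⟨e ⟨a, ha⟩, Or.inl ?_, h a ha _ (e _).2, h a' ha' _ (e _).2⟩
      rw [hT a ha]
      exact Finset.mem_singleton_self _

/-- `v` can be reached from `u` in `G - S` by a walk of length at most `n`. -/
def ReachAvoiding {V : Type} (G : SimpleGraph V) (S : Set V) (n : ℕ) (u v : V) : Prop :=
  ∃ p : G.Walk u v, p.length ≤ n ∧ ∀ x ∈ p.support, x ∉ S

namespace ReachAvoiding

variable {V : Type} {G : SimpleGraph V} {S S' : Set V} {m n : ℕ} {u v w : V}

theorem refl (hu : u ∉ S) : ReachAvoiding G S n u u :=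
  ⟨Walk.nil, by simp, by simpa using hu⟩

theorem of_adj (h : G.Adj u v) (hu : u ∉ S) (hv : v ∉ S) : ReachAvoiding G S 1 u v :=
  ⟨h.toWalk, by simp, by simp [hu, hv]⟩

theorem mono (h : ReachAvoiding G S m u v) (hmn : m ≤ n) : ReachAvoiding G S n u v :=
  let ⟨p, hp, hS⟩ := h
  ⟨p, hp.trans hmn, hS⟩

theorem anti (h : ReachAvoiding G S m u v) (hS : S' ⊆ S) : ReachAvoiding G S' m u v :=
  let ⟨p, hp, hpS⟩ := h
  ⟨p, hp, fun x hx hx' => hpS x hx (hS hx')⟩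

theorem symm (h : ReachAvoiding G S n u v) : ReachAvoiding G S n v u :=
  let ⟨p, hp, hS⟩ := h
  ⟨p.reverse, by simpa using hp, by simpa using hS⟩

theorem trans (h : ReachAvoiding G S m u v) (h' : ReachAvoiding G S n v w) :
    ReachAvoiding G S (m + n) u w := by
  obtain ⟨p, hp, hS⟩ := h
  obtain ⟨q, hq, hS'⟩ := h'
  refine ⟨p.append q, by rw [Walk.length_append]; omega, fun x hx => ?_⟩
  rcases Walk.mem_support_append_iff _ _ |>.mp hx with h | h
  exacts [hS x h, hS' x h]

theorem left_notMem (h : ReachAvoiding G S n u v) : u ∉ S :=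
  let ⟨p, _, hS⟩ := h
  hS u p.start_mem_support

theorem right_notMem (h : ReachAvoiding G S n u v) : v ∉ S :=
  h.symm.left_notMem

theorem split (h : ReachAvoiding G S (m + n) u v) :
    ∃ w, ReachAvoiding G S m u w ∧ ReachAvoiding G S n w v := by
  obtain ⟨p, hp, hS⟩ := h
  induction m generalizing u with
  | zero => exact ⟨u, refl (hS u p.start_mem_support), p, by omega, hS⟩
  | succ m ih =>
    cases p with
    | nil => exact ⟨v, refl (hS v (by simp)), refl (hS v (by simp))⟩
    | cons h q =>
      rw [Walk.length_cons] at hp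
      obtain ⟨w, h₁, h₂⟩ := ih q (by omega) fun x hx => hS x (by simp [hx])
      refine ⟨w, ?_, h₂⟩
      rw [Nat.add_comm m 1]
      exact (of_adj h (hS u (by simp)) h₁.left_notMem).trans h₁

theorem eq_or_adj (h : ReachAvoiding G S 1 u v) : u = v ∨ G.Adj u v := by
  obtain ⟨p, hp, -⟩ := h
  cases p with
  | nil => exact Or.inl rfl
  | cons h q =>
    rw [Walk.length_cons] at hp
    exact Or.inr (Walk.eq_of_length_eq_zero (p := q) (by omega) ▸ h)

theorem of_hom {U : Type} {H : SimpleGraph U} (f : H →g G) (hf : ∀ x, f x ∉ S) {a b : U}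
    (p : H.Walk a b) : ReachAvoiding G S p.length (f a) (f b) := by
  refine ⟨p.map f, (p.length_map f).le, fun x hx => ?_⟩
  rw [Walk.support_map, List.mem_map] at hx
  obtain ⟨y, -, rfl⟩ := hx
  exact hf y

theorem exists_walk_induce (h : ReachAvoiding G S n u v) {X : Set V} (hu : u ∈ X) (hv : v ∈ X)
    (hX : ∀ x, ReachAvoiding G S n u x → x ∈ X) :
    ∃ p : (G.induce X).Walk ⟨u, hu⟩ ⟨v, hv⟩, p.length ≤ n := by
  obtain ⟨p, hp, hS⟩ := h
  have hpX : ∀ x ∈ p.support, x ∈ X := fun x hx => by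
    classical
    refine hX x ⟨p.takeUntil x hx, (p.length_takeUntil_le_length hx).trans hp, fun y hy => ?_⟩
    exact hS y (p.support_takeUntil_subset_support hx hy)
  refine ⟨p.induce X hpX, ?_⟩
  rwa [← Walk.length_map (Embedding.induce X).toHom, Walk.map_induce]

end ReachAvoiding

theorem distIndepIn_iff {V : Type} {G : SimpleGraph V} {S : Set V} {r : ℕ} {B : Set V} :
    DistIndepIn G S r B ↔ B.Pairwise fun u v => ¬ ReachAvoiding G S r u v :=
  ⟨fun h _ hu _ hv hne ⟨p, hp, hS⟩ => (h _ hu _ hv hne p hS).not_ge hp,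
    fun h _ hu _ hv hne p hS => lt_of_not_ge fun hp => h hu hv hne ⟨p, hp, hS⟩⟩

theorem isDepthMinor_top_of_finset {V : Type} {G : SimpleGraph V} {r : ℕ} {K : Finset V}
    (φ : V → Set V) (hr : ∀ a ∈ K, hasRadiusLE (G.induce (φ a)) r)
    (hd : ∀ a ∈ K, ∀ a' ∈ K, a ≠ a' → Disjoint (φ a) (φ a'))
    (he : ∀ a ∈ K, ∀ a' ∈ K, a ≠ a' → ∃ u ∈ φ a, ∃ v ∈ φ a', G.Adj u v) :
    IsDepthMinor r (⊤ : SimpleGraph (Fin K.card)) G := by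
  have hne : ∀ {i j : Fin K.card}, i ≠ j → (K.equivFin.symm i).1 ≠ (K.equivFin.symm j).1 :=
    fun h h' => h (K.equivFin.symm.injective (Subtype.ext h'))
  exact ⟨fun i => φ (K.equivFin.symm i), fun i => hr _ (K.equivFin.symm i).2,
    fun i j h => hd _ (K.equivFin.symm i).2 _ (K.equivFin.symm j).2 (hne h),
    fun i j h => he _ (K.equivFin.symm i).2 _ (K.equivFin.symm j).2 (hne h.ne)⟩

/-- If the members of a `2 * i`-independent set are pairwise at distance at most `2 * i + 1`, then
they yield a clique minor. -/
theorem isDepthMinor_of_pairwise_reachAvoiding {V : Type} {G : SimpleGraph V} {S : Set V} {i : ℕ}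
    {K : Finset V} (hKS : ∀ a ∈ K, a ∉ S)
    (hK : (K : Set V).Pairwise fun u v => ¬ ReachAvoiding G S (2 * i) u v)
    (hK' : (K : Set V).Pairwise fun u v => ReachAvoiding G S (2 * i + 1) u v) :
    IsDepthMinor i (⊤ : SimpleGraph (Fin K.card)) G := by
  refine isDepthMinor_top_of_finset (fun a => {x | ReachAvoiding G S i a x}) ?_ ?_ ?_
  · exact fun a ha => ⟨⟨a, .refl (hKS a ha)⟩, fun ⟨v, hv⟩ =>
      ReachAvoiding.exists_walk_induce hv _ _ fun x hx => hx⟩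
  · refine fun a ha a' ha' hne => Set.disjoint_left.mpr fun x hx hx' => hK ha ha' hne ?_
    exact (hx.trans hx'.symm).mono (by omega)
  · intro a ha a' ha' hne
    have h := hK' ha ha' hne
    rw [show 2 * i + 1 = i + (1 + i) by ring] at h
    obtain ⟨u, hu, h⟩ := h.split
    obtain ⟨v, huv, hv⟩ := h.split
    refine ⟨u, hu, v, hv.symm, huv.eq_or_adj.resolve_left ?_⟩
    rintro rfl
    exact hK ha ha' hne ((hu.trans hv).mono (by omega))

/-- A star model over a `(2 * i + 1)`-independent set yields a clique minor. -/
theorem isDepthMinor_of_isStarModel {V : Type} {G : SimpleGraph V} {S : Set V} {i : ℕ}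
    {K : Finset V} {T : V → Finset V} (hKS : ∀ a ∈ K, a ∉ S)
    (hK : (K : Set V).Pairwise fun u v => ¬ ReachAvoiding G S (2 * i + 1) u v)
    (hT : IsStarModel (fun a b => b ∉ S ∧ ∃ u, ReachAvoiding G S i a u ∧ G.Adj u b) K T) :
    IsDepthMinor (i + 1) (⊤ : SimpleGraph (Fin K.card)) G := by
  have hreach : ∀ a b, (b ∉ S ∧ ∃ u, ReachAvoiding G S i a u ∧ G.Adj u b) →
      ReachAvoiding G S (i + 1) a b :=
    fun a b ⟨hb, u, hu, hub⟩ => hu.trans (.of_adj hub hu.right_notMem hb)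
  obtain ⟨hT₁, hT₂, hT₃⟩ := hT
  have hball : ∀ a ∈ K, ∀ a' ∈ K, a ≠ a' → ∀ x ∈ T a', ¬ ReachAvoiding G S i a x :=
    fun a ha a' ha' hne x hx hx' => hK ha ha' hne
      ((hx'.trans (hreach _ _ (hT₁ a' ha' x hx)).symm).mono (by omega))
  refine isDepthMinor_top_of_finset (fun a => {x | ReachAvoiding G S i a x ∨ x ∈ T a}) ?_ ?_ ?_
  · refine fun a ha => ⟨⟨a, .inl (.refl (hKS a ha))⟩, ?_⟩
    have key : ∀ v (hv : ReachAvoiding G S i a v), ∃ p : (G.induce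
        {x | ReachAvoiding G S i a x ∨ x ∈ T a}).Walk ⟨a, .inl (.refl (hKS a ha))⟩ ⟨v, .inl hv⟩,
        p.length ≤ i :=
      fun v hv => hv.exists_walk_induce _ _ fun x hx => .inl hx
    rintro ⟨v, hv | hv⟩
    · obtain ⟨p, hp⟩ := key v hv
      exact ⟨p, by omega⟩
    · obtain ⟨-, u, hu, huv⟩ := hT₁ a ha v hv
      obtain ⟨p, hp⟩ := key u hu
      refine ⟨p.concat (w := ⟨v, .inr hv⟩) (induce_adj.mpr huv), ?_⟩
      rw [Walk.length_concat]
      omega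
  · refine fun a ha a' ha' hne => Set.disjoint_left.mpr ?_
    rintro x (hx | hx) (hx' | hx')
    · exact hK ha ha' hne ((hx.trans hx'.symm).mono (by omega))
    · exact hball a ha a' ha' hne x hx' hx
    · exact hball a' ha' a ha hne.symm x hx hx'
    · exact Finset.disjoint_left.mp (hT₂ a ha a' ha' hne) hx hx'
  · intro a ha a' ha' hne
    obtain ⟨b, hb | hb, ⟨-, u, hu, hub⟩, -, u', hu', hub'⟩ := hT₃ a ha a' ha' hne
    · exact ⟨b, .inr hb, u', .inl hu', hub'.symm⟩
    · exact ⟨u, .inl hu, b, .inr hb, hub⟩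

/-- Nowhere dense classes are uniformly quasi-wide. -/
theorem NowhereDense.exists_scattered {C : Set FGraph} (hC : NowhereDense C) (i : ℕ) :
    ∃ s : ℕ, ∀ t : ℕ, ∃ N : ℕ, ∀ G ∈ C, ∀ A : Finset G.V, N ≤ A.card →
      ∃ S : Finset G.V, S.card ≤ s ∧ ∃ B ⊆ A, B.card = t ∧ (∀ b ∈ B, b ∉ S) ∧
        DistIndepIn G.G S (2 * i) B := by
  classical
  simp only [distIndepIn_iff]
  induction i with
  | zero =>
    refine ⟨0, fun t => ⟨t, fun G _ A hA => ⟨∅, le_rfl, ?_⟩⟩⟩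
    obtain ⟨B, hBA, hB⟩ := Finset.exists_subset_card_eq hA
    refine ⟨B, hBA, hB, by simp, fun u _ v _ hne ⟨p, hp, _⟩ => hne ?_⟩
    exact Walk.eq_of_length_eq_zero (p := p) (by omega)
  | succ i ih =>
    obtain ⟨s, hs⟩ := ih
    obtain ⟨m₀, hm₀⟩ := hC i
    obtain ⟨m₁, hm₁⟩ := hC (i + 1)
    refine ⟨s + m₁, fun t => ?_⟩
    obtain ⟨N₁, h₁⟩ := exists_unshared_or_isStarModel m₁ (t + m₁)
    obtain ⟨N₂, h₂⟩ := exists_ramsey m₀ N₁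
    obtain ⟨N₃, h₃⟩ := hs N₂
    refine ⟨N₃, fun G hG A hA => ?_⟩
    obtain ⟨S, hS, A₁, hA₁, hA₁c, hA₁S, hA₁i⟩ := h₃ G hG A hA
    rcases h₂ G.V (ReachAvoiding G.G S (2 * i + 1)) (fun _ _ h => h.symm) A₁ hA₁c.ge with
      ⟨K, hKA, rfl, hKR⟩ | ⟨A₂, hA₂, hA₂c, hA₂i⟩
    · exact absurd (isDepthMinor_of_pairwise_reachAvoiding (fun a ha => hA₁S a (hKA ha))
        (hA₁i.mono (by exact_mod_cast hKA)) hKR) (hm₀ G hG)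
    have hA₂S : ∀ a ∈ A₂, a ∉ (S : Set G.V) := fun a ha => hA₁S a (hA₂ ha)
    rcases h₁ G.V G.V (fun a b => b ∉ (S : Set G.V) ∧
      ∃ u, ReachAvoiding G.G S i a u ∧ G.G.Adj u b) A₂ hA₂c.ge with
      ⟨W, hW, I, hIA, hI, hIW⟩ | ⟨K, hKA, T, rfl, hT⟩
    · obtain ⟨B, hBI, hB⟩ := Finset.exists_subset_card_eq (s := I \ W) (n := t) <| by
        have := Finset.le_card_sdiff W I
        omega
      have hBI' : ∀ b ∈ B, b ∈ I ∧ b ∉ W := fun b hb => Finset.mem_sdiff.mp (hBI hb)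
      refine ⟨S ∪ W, (Finset.card_union_le _ _).trans (by omega), B,
        fun b hb => hA₁ (hA₂ (hIA (hBI' b hb).1)), hB, fun b hb h => ?_, ?_⟩
      · exact (Finset.mem_union.mp h).elim (hA₂S b (hIA (hBI' b hb).1)) (hBI' b hb).2
      · intro a ha a' ha' hne h
        rw [Finset.mem_coe] at ha ha'
        have haI := (hBI' a ha).1
        have haI' := (hBI' a' ha').1
        have hsep := hA₂i (hIA haI) (hIA haI') hne
        rw [show 2 * (i + 1) = i + 1 + (i + 1) by ring] at h
        obtain ⟨b, hb, hb'⟩ := h.split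
        have hbW : b ∉ W := fun hbW => hb.right_notMem (by simp [hbW])
        have hsub : (S : Set G.V) ⊆ ((S ∪ W : Finset G.V) : Set G.V) := by simp
        replace hb := hb.anti hsub
        replace hb' := hb'.symm.anti hsub
        refine hbW (hIW a haI a' haI' hne b ⟨hb.right_notMem, ?_⟩ ⟨hb.right_notMem, ?_⟩)
        · obtain ⟨u, hu, hub⟩ := hb.split
          refine ⟨u, hu, hub.eq_or_adj.resolve_left ?_⟩
          rintro rfl
          exact hsep ((hu.trans hb'.symm).mono (by omega))
        · obtain ⟨u, hu, hub⟩ := hb'.split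
          refine ⟨u, hu, hub.eq_or_adj.resolve_left ?_⟩
          rintro rfl
          exact hsep ((hb.trans hu.symm).mono (by omega))
    · exact absurd (isDepthMinor_of_isStarModel (fun a ha => hA₂S a (hKA ha))
        (hA₂i.mono (by exact_mod_cast hKA)) hT) (hm₁ G hG)

/-- The splitter game on the subgraph of `G` induced by `X`, with connector always choosing a full
ball and splitter allowed to delete any vertex. -/
def SplitterWinsOn {V : Type} (G : SimpleGraph V) (r : ℕ) : ℕ → Set V → Prop
  | 0, X => X = ∅
  | ℓ + 1, X => ∀ v ∈ X, ∃ w, SplitterWinsOn G r ℓ ({x | ReachAvoiding G Xᶜ r v x} \ {w})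

namespace SplitterWinsOn

variable {V : Type} {G : SimpleGraph V} {r ℓ k : ℕ} {X Y : Set V}

theorem mono (h : SplitterWinsOn G r ℓ X) (hYX : Y ⊆ X) : SplitterWinsOn G r ℓ Y := by
  induction ℓ generalizing X Y with
  | zero => exact Set.subset_eq_empty hYX h
  | succ ℓ ih =>
    intro v hv
    obtain ⟨w, hw⟩ := h v (hYX hv)
    exact ⟨w, ih hw (Set.sdiff_subset_sdiff_left fun x hx =>
      hx.anti (Set.compl_subset_compl.mpr hYX))⟩

theorem succ (h : SplitterWinsOn G r ℓ X) : SplitterWinsOn G r (ℓ + 1) X := by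
  induction ℓ generalizing X with
  | zero =>
    intro v hv
    rw [show X = ∅ from h] at hv
    exact hv.elim
  | succ ℓ ih =>
    intro v hv
    obtain ⟨w, hw⟩ := h v hv
    exact ⟨w, ih hw⟩

theorem reach_subset (v : V) : {x | ReachAvoiding G Xᶜ r v x} ⊆ X :=
  fun _ hx => not_not.mp hx.right_notMem

theorem of_diff (W : Finset V) (hW : W.card ≤ k) (h : SplitterWinsOn G r ℓ (X \ W)) :
    SplitterWinsOn G r (ℓ + k) X := by
  classical
  induction k generalizing X W with
  | zero =>
    rw [Nat.le_zero, Finset.card_eq_zero] at hW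
    simpa [hW] using h
  | succ k ih =>
    rcases W.eq_empty_or_nonempty with rfl | ⟨w, hw⟩
    · exact (ih ∅ (Nat.zero_le _) h).succ
    · refine fun v _ => ⟨w, ih (W.erase w) ?_ (h.mono ?_)⟩
      · rw [Finset.card_erase_of_mem hw]
        omega
      · rintro x ⟨⟨hx, hxw⟩, hxW⟩
        refine ⟨reach_subset v hx, fun h => hxW ?_⟩
        exact Finset.mem_coe.mpr (Finset.mem_erase.mpr ⟨hxw, h⟩)

theorem splitterWins {U : Type} {H : SimpleGraph U} (f : H →g G) (hf : Function.Injective f)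
    (hfX : ∀ u, f u ∈ X) (h : SplitterWinsOn G r ℓ X) : SplitterWins r ℓ U H := by
  induction ℓ generalizing U X with
  | zero => exact ⟨fun u => by simpa [show X = ∅ from h] using hfX u⟩
  | succ ℓ ih =>
    rintro C ⟨c, hc⟩
    obtain ⟨w, hw⟩ := h (f c) (hfX c)
    have hreach : ∀ u ∈ C.verts, ReachAvoiding G Xᶜ r (f c) (f u) := fun u hu => by
      obtain ⟨p, hp⟩ := hc ⟨u, hu⟩
      exact (ReachAvoiding.of_hom (f.comp C.hom) (fun y => not_not.mpr (hfX _)) p).mono hp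
    obtain ⟨d, hd, hdw⟩ : ∃ d ∈ C.verts, ∀ u ∈ C.verts, u ≠ d → f u ≠ w := by
      by_cases hw' : ∃ d ∈ C.verts, f d = w
      · obtain ⟨d, hd, rfl⟩ := hw'
        exact ⟨d, hd, fun u _ hu => hf.ne hu⟩
      · exact ⟨c, c.2, fun u hu _ h => hw' ⟨u, hu, h⟩⟩
    exact ⟨d, hd, ih (f.comp (C.deleteVerts {d}).hom) (hf.comp Subtype.val_injective)
      (fun u => Set.mem_sdiff_singleton.mpr ⟨hreach u.1 u.2.1, hdw u.1 u.2.1 u.2.2⟩) hw⟩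

end SplitterWinsOn

/-- A play of `n` rounds in which connector picks the centres `v i` in the arenas `Z i`, the set
`P i j` is the support of a walk from `v i` to `v j`, and `Y` is the final arena. -/
structure IsLongPlay {V : Type} (G : SimpleGraph V) (r n : ℕ) (v : ℕ → V) (Z : ℕ → Set V)
    (P : ℕ → ℕ → Finset V) (Y : Set V) : Prop where
  walk : ∀ i j, i ≤ j → j < n → ReachAvoiding G (P i j : Set V)ᶜ r (v i) (v j)
  subset : ∀ i j, i ≤ j → j < n → (P i j : Set V) ⊆ Z i
  disjoint : ∀ i j k, i ≤ j → j < k → k < n → Disjoint (P i j : Set V) (Z k)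
  disjoint_last : ∀ i j, i ≤ j → j < n → Disjoint (P i j : Set V) Y
  reach : ∀ i < n, ∀ y ∈ Y, ReachAvoiding G (Z i)ᶜ r (v i) y

theorem exists_isLongPlay (r n L' : ℕ) : ∃ L : ℕ, ∀ (V : Type) (G : SimpleGraph V) (X : Set V),
    ¬ SplitterWinsOn G r L X →
    ∃ v Z P Y, IsLongPlay G r n v Z P Y ∧ ¬ SplitterWinsOn G r L' Y := by
  classical
  induction n generalizing L' with
  | zero =>
    refine ⟨L' + 1, fun V G X hX => ?_⟩
    have : Nonempty V := by
      by_contra hV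
      rw [not_nonempty_iff] at hV
      exact hX fun v => hV.elim v
    obtain ⟨x⟩ := this
    exact ⟨fun _ => x, fun _ => ∅, fun _ _ => ∅, X,
      ⟨by simp, by simp, by simp, by simp, by simp⟩, fun h => hX h.succ⟩
  | succ n ih =>
    obtain ⟨L, hL⟩ := ih (L' + (n + 1) * (r + 1) + 1)
    refine ⟨L, fun V G X hX => ?_⟩
    obtain ⟨v, Z, P, Y, hP, hY⟩ := hL V G X hX
    simp only [SplitterWinsOn, not_forall, not_exists] at hY
    obtain ⟨c, hcY, hY⟩ := hY
    have hwalk : ∀ i, ∃ Q : Finset V, i ≤ n → Q.card ≤ r + 1 ∧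
        ReachAvoiding G (Q : Set V)ᶜ r (if i = n then c else v i) c ∧
        (Q : Set V) ⊆ (if i = n then Y else Z i) := by
      intro i
      by_cases hi : i < n
      · obtain ⟨p, hp, hpZ⟩ := hP.reach i hi c hcY
        refine ⟨p.support.toFinset, fun _ => ⟨?_, ?_, ?_⟩⟩
        · have := p.support.toFinset_card_le
          rw [Walk.length_support] at this
          omega
        · rw [if_neg hi.ne]
          exact ⟨p, hp, fun x hx => not_not.mpr (Finset.mem_coe.mpr (List.mem_toFinset.mpr hx))⟩
        · rw [if_neg hi.ne]
          exact fun x hx => not_not.mp (hpZ x (List.mem_toFinset.mp (Finset.mem_coe.mp hx)))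
      · refine ⟨{c}, fun hi' => ?_⟩
        obtain rfl : i = n := by omega
        refine ⟨by simp, ?_, by simpa using hcY⟩
        rw [if_pos rfl]
        exact .refl (by simp)
    choose Q hQ using hwalk
    let W : Finset V := (Finset.range (n + 1)).biUnion Q
    have hQW : ∀ i ≤ n, Q i ⊆ W := fun i hi =>
      Finset.subset_biUnion_of_mem Q (Finset.mem_range.mpr (by omega))
    have hW : W.card ≤ (n + 1) * (r + 1) := by
      have := Finset.card_biUnion_le_card_mul (Finset.range (n + 1)) Q (r + 1)
        fun i hi => (hQ i (by have := Finset.mem_range.mp hi; omega)).1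
      rwa [Finset.card_range] at this
    have hBY : {x | ReachAvoiding G Yᶜ r c x} ⊆ Y := SplitterWinsOn.reach_subset c
    refine ⟨fun i => if i = n then c else v i, fun i => if i = n then Y else Z i,
      fun i j => if j = n then Q i else P i j, {x | ReachAvoiding G Yᶜ r c x} \ W,
      ⟨?_, ?_, ?_, ?_, ?_⟩, fun h => hY c ?_⟩
    · intro i j hij hj
      by_cases hjn : j = n
      · simpa only [if_pos hjn] using (hQ i (by omega)).2.1
      · have hin : i ≠ n := by omega
        simpa only [if_neg hjn, if_neg hin] using hP.walk i j hij (by omega)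
    · intro i j hij hj
      by_cases hjn : j = n
      · simpa only [if_pos hjn] using (hQ i (by omega)).2.2
      · simpa only [if_neg hjn, if_neg (show i ≠ n by omega)] using hP.subset i j hij (by omega)
    · intro i j k hij hjk hk
      rw [if_neg (show j ≠ n by omega)]
      by_cases hkn : k = n
      · simpa only [if_pos hkn] using hP.disjoint_last i j hij (by omega)
      · simpa only [if_neg hkn] using hP.disjoint i j k hij hjk (by omega)
    · intro i j hij hj
      by_cases hjn : j = n
      · simp only [if_pos hjn]
        exact Set.disjoint_left.mpr fun x hx hx' => hx'.2 (hQW i (by omega) hx)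
      · simp only [if_neg hjn]
        exact (hP.disjoint_last i j hij (by omega)).mono_right (Set.sdiff_subset.trans hBY)
    · intro i hi y hy
      by_cases hin : i = n
      · simp only [if_pos hin]
        exact hy.1
      · simpa only [if_neg hin] using hP.reach i (by omega) y (hBY hy.1)
    · exact SplitterWinsOn.of_diff W hW h |>.mono Set.sdiff_subset

theorem IsLongPlay.injOn {V : Type} {G : SimpleGraph V} {r n : ℕ} {v : ℕ → V} {Z : ℕ → Set V}
    {P : ℕ → ℕ → Finset V} {Y : Set V} (h : IsLongPlay G r n v Z P Y) :
    Set.InjOn v (Finset.range n) := by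
  have hmem : ∀ i < n, v i ∈ (P i i : Set V) := fun i hi =>
    not_not.mp (h.walk i i le_rfl hi).left_notMem
  have key : ∀ i j, i < j → j < n → v i ≠ v j := fun i j hij hj heq =>
    Set.disjoint_left.mp (h.disjoint i i j le_rfl hij hj) (hmem i (by omega))
      (heq ▸ h.subset j j le_rfl hj (hmem j hj))
  intro i hi j hj heq
  rw [Finset.mem_coe, Finset.mem_range] at hi hj
  rcases lt_trichotomy i j with hij | hij | hij
  exacts [absurd heq (key i j hij hj), hij, absurd heq.symm (key j i hij hi)]

/-- In a long play, few deletions cannot scatter many of the chosen centres. -/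
theorem IsLongPlay.not_distIndepIn {V : Type} {G : SimpleGraph V} {r n : ℕ} {v : ℕ → V}
    {Z : ℕ → Set V} {P : ℕ → ℕ → Finset V} {Y : Set V} (h : IsLongPlay G r n v Z P Y)
    {S : Finset V} {I : Finset ℕ} (hI : I ⊆ Finset.range n) (hcard : I.card = 2 * (S.card + 1)) :
    ¬ DistIndepIn G S r (v '' I) := by
  intro hind
  let f := I.orderEmbOfFin hcard
  have hfI : ∀ k, f k ∈ I := fun k => I.orderEmbOfFin_mem hcard k
  have hfn : ∀ k, f k < n := fun k => Finset.mem_range.mp (hI (hfI k))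
  let a : Fin (S.card + 1) → ℕ := fun k => f ⟨2 * k, by omega⟩
  let b : Fin (S.card + 1) → ℕ := fun k => f ⟨2 * k + 1, by omega⟩
  have hab : ∀ k, a k < b k := fun k => f.strictMono (Fin.mk_lt_mk.mpr (by omega))
  have hba : ∀ k l, k < l → b k < a l := fun k l hkl =>
    f.strictMono (Fin.mk_lt_mk.mpr (by have : k.1 < l.1 := hkl; omega))
  have hmeet : ∀ k, ∃ x ∈ S, x ∈ P (a k) (b k) := fun k => by
    obtain ⟨p, hp, hpP⟩ := h.walk (a k) (b k) (hab k).le (hfn _)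
    by_contra! hS
    refine (hind (v (a k)) ⟨_, hfI _, rfl⟩ (v (b k)) ⟨_, hfI _, rfl⟩ ?_ p
      fun x hx hxS => hS x hxS (not_not.mp (hpP x hx))).not_ge hp
    intro heq
    exact (hab k).ne (h.injOn (hI (hfI _)) (hI (hfI _)) heq)
  choose x hxS hxP using hmeet
  have hne : ∀ k l, k < l → x k ≠ x l := fun k l hkl heq =>
    Set.disjoint_left.mp (h.disjoint (a k) (b k) (a l) (hab k).le (hba k l hkl) (hfn _)) (hxP k)
      (heq ▸ h.subset (a l) (b l) (hab l).le (hfn _) (hxP l))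
  have hinj : Function.Injective x := fun k l heq => by
    rcases lt_trichotomy k l with hkl | hkl | hkl
    exacts [absurd heq (hne k l hkl), hkl, absurd heq.symm (hne l k hkl)]
  have := Finset.card_le_card_of_injOn (s := Finset.univ) (t := S) x (fun k _ => hxS k) hinj.injOn
  rw [Finset.card_univ, Fintype.card_fin] at this
  omega

theorem NowhereDense.exists_splitterWins {C : Set FGraph} (hC : NowhereDense C) (r : ℕ) :
    ∃ ℓ : ℕ, ∀ G ∈ C, SplitterWins r ℓ G.V G.G := by
  classical
  obtain ⟨s, hs⟩ := hC.exists_scattered r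
  obtain ⟨N, hN⟩ := hs (2 * (s + 1))
  obtain ⟨L, hL⟩ := exists_isLongPlay r N 0
  refine ⟨L, fun G hG => SplitterWinsOn.splitterWins (X := Set.univ) Hom.id
    Function.injective_id (fun _ => trivial) ?_⟩
  by_contra hlose
  obtain ⟨v, Z, P, Y, hP, -⟩ := hL G.V G.G _ hlose
  obtain ⟨S, hS, B, hBA, hB, -, hind⟩ := hN G hG ((Finset.range N).image v) <| by
    rw [Finset.card_image_of_injOn hP.injOn, Finset.card_range]
  obtain ⟨J, hJ, rfl⟩ := Finset.subset_image_iff.mp hBA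
  rw [Finset.card_image_of_injOn (hP.injOn.mono (by exact_mod_cast hJ))] at hB
  obtain ⟨I, hIJ, hI⟩ := Finset.exists_subset_card_eq (s := J) (n := 2 * (S.card + 1)) (by omega)
  refine hP.not_distIndepIn (hIJ.trans hJ) hI fun x hx y hy hne p hp => ?_
  have hsub : v '' I ⊆ ((J.image v : Finset G.V) : Set G.V) := by
    rw [Finset.coe_image]
    exact Set.image_mono (by exact_mod_cast hIJ)
  have := hind x (hsub hx) y (hsub hy) hne p hp
  omega

theorem hasRadiusLE.map {U V : Type} {H : SimpleGraph U} {G : SimpleGraph V} {r : ℕ}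
    (h : hasRadiusLE H r) (f : H →g G) (hf : Function.Surjective f) : hasRadiusLE G r := by
  obtain ⟨u, hu⟩ := h
  refine ⟨f u, fun v => ?_⟩
  obtain ⟨w, rfl⟩ := hf v
  obtain ⟨p, hp⟩ := hu w
  exact ⟨p.map f, by simpa using hp⟩

theorem hasRadiusLE.exists_walk {V : Type} {G : SimpleGraph V} {r : ℕ} (h : hasRadiusLE G r)
    (u v : V) : ∃ p : G.Walk u v, p.length ≤ 2 * r := by
  obtain ⟨c, hc⟩ := h
  obtain ⟨p, hp⟩ := hc u
  obtain ⟨q, hq⟩ := hc v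
  exact ⟨p.reverse.append q, by rw [Walk.length_append, Walk.length_reverse]; omega⟩

/-- The union of the branch sets of a shallow clique minor has small radius. -/
theorem hasRadiusLE_iUnion {V W : Type} {G : SimpleGraph V} {r : ℕ} {φ : W → Set V} (w₀ : W)
    (hr : ∀ w, hasRadiusLE (G.induce (φ w)) r)
    (he : ∀ a b, a ≠ b → ∃ u ∈ φ a, ∃ v ∈ φ b, G.Adj u v) :
    hasRadiusLE (G.induce (⋃ w, φ w)) (3 * r + 1) := by
  let ι : ∀ w, G.induce (φ w) →g G.induce (⋃ w, φ w) := fun w =>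
    (G.induceHomOfLE (Set.subset_iUnion φ w)).toHom
  obtain ⟨c, hc⟩ := hr w₀
  suffices ∀ w v, ∃ p : (G.induce (⋃ w, φ w)).Walk (ι w₀ c) (ι w v), p.length ≤ 3 * r + 1 by
    refine ⟨ι w₀ c, fun ⟨v, hv⟩ => ?_⟩
    obtain ⟨w, hw⟩ := Set.mem_iUnion.mp hv
    exact this w ⟨v, hw⟩
  intro w v
  by_cases hww : w₀ = w
  · subst hww
    obtain ⟨p, hp⟩ := hc v
    exact ⟨p.map (ι w₀), by rw [Walk.length_map]; omega⟩
  · obtain ⟨x, hx, y, hy, hxy⟩ := he w₀ w hww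
    obtain ⟨p, hp⟩ := hc ⟨x, hx⟩
    obtain ⟨q, hq⟩ := (hr w).exists_walk ⟨y, hy⟩ v
    have hadj : (G.induce (⋃ w, φ w)).Adj (ι w₀ ⟨x, hx⟩) (ι w ⟨y, hy⟩) := hxy
    refine ⟨(p.map (ι w₀)).append (.cons hadj (q.map (ι w))), ?_⟩
    rw [Walk.length_append, Walk.length_cons, Walk.length_map, Walk.length_map]
    omega

theorem not_splitterWins_of_isDepthMinor {r ℓ : ℕ} {V : Type} {G : SimpleGraph V}
    (h : IsDepthMinor r (⊤ : SimpleGraph (Fin (ℓ + 1))) G) :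
    ¬ SplitterWins (3 * r + 1) ℓ V G := by
  induction ℓ generalizing V with
  | zero =>
    obtain ⟨φ, hr, -, -⟩ := h
    obtain ⟨c, -⟩ := hr 0
    exact fun hV => hV.elim c.1
  | succ ℓ ih =>
    obtain ⟨φ, hr, hd, he⟩ := h
    intro hwin
    let D : G.Subgraph := (⊤ : G.Subgraph).induce (⋃ i, φ i)
    have hrad : hasRadiusLE D.coe (3 * r + 1) :=
      (hasRadiusLE_iUnion 0 hr he).map ⟨fun x => ⟨x.1, x.2⟩, fun {x y} hxy =>
        ⟨x.2, y.2, hxy⟩⟩ fun x => ⟨⟨x.1, x.2⟩, rfl⟩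
    obtain ⟨w, hw, hwin⟩ := hwin D hrad
    obtain ⟨i, hi⟩ := Set.mem_iUnion.mp hw
    have hmem : ∀ j, ∀ x ∈ φ (i.succAbove j), x ∈ (D.deleteVerts {w}).verts := fun j x hx =>
      ⟨Set.mem_iUnion.mpr ⟨_, hx⟩, fun hxw =>
        Set.disjoint_left.mp (hd (i.succAbove_ne j)) hx (Set.mem_singleton_iff.mp hxw ▸ hi)⟩
    have hadj : ∀ j j' x y, ∀ (hx : x ∈ φ (i.succAbove j)) (hy : y ∈ φ (i.succAbove j')),
        G.Adj x y → (D.deleteVerts {w}).coe.Adj ⟨x, hmem j x hx⟩ ⟨y, hmem j' y hy⟩ :=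
      fun j j' x y hx hy hxy => by
        have h₁ := hmem j x hx
        have h₂ := hmem j' y hy
        exact Subgraph.deleteVerts_adj.mpr ⟨h₁.1, h₁.2, h₂.1, h₂.2, h₁.1, h₂.1, hxy⟩
    refine ih ⟨fun j => Subtype.val ⁻¹' φ (i.succAbove j), fun j => ?_, fun j j' hjj' => ?_,
      fun j j' hjj' => ?_⟩ hwin
    · exact (hr (i.succAbove j)).map ⟨fun x => ⟨⟨x.1, hmem j x.1 x.2⟩, x.2⟩,
        fun {x y} hxy => hadj j j _ _ x.2 y.2 hxy⟩ fun x => ⟨⟨x.1.1, x.2⟩, rfl⟩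
    · exact (hd (i.succAbove_right_injective.ne hjj')).preimage _
    · obtain ⟨x, hx, y, hy, hxy⟩ := he _ _ (i.succAbove_right_injective.ne hjj'.ne)
      exact ⟨⟨x, hmem j x hx⟩, hx, ⟨y, hmem j' y hy⟩, hy, hadj j j' x y hx hy hxy⟩

/-- A class is nowhere dense iff for every `r` there is `ℓ` such that
splitter wins the simple `ℓ`-round radius-`r` splitter game on every member. -/
theorem stmt4 (C : Set FGraph) :
    NowhereDense C ↔ ∀ r : ℕ, ∃ ℓ : ℕ, ∀ G ∈ C, SplitterWins r ℓ G.V G.G := by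
  refine ⟨fun h r => h.exists_splitterWins r, fun h r => ?_⟩
  obtain ⟨ℓ, hℓ⟩ := h (3 * r + 1)
  exact ⟨ℓ + 1, fun G hG hminor => not_splitterWins_of_isDepthMinor hminor (hℓ G hG)⟩
end

section
/- A class 𝒞 of graphs is nowhere dense if and only if the class 𝒞_⊆ = {H : H is a subgraph of some G ∈ 𝒞} admits sparse neighborhood covers, i.e., there exists c ∈ ℕ and for all r ∈ ℕ and all real ε > 0 a number d = d(r,ε) such that every n-vertex graph G ∈ 𝒞_⊆ admits an r-neighborhood cover of radius at most c·r in which every vertex belongs to at most d·n^ε clusters. -/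
open SimpleGraph

variable {V : Type} {W : Type}

namespace SparseCovers

open scoped Classical

section Walks

/-- `u` and `v` are joined by a walk of length at most `n` all of whose vertices lie in `A`. -/
def WalkIn (G : SimpleGraph V) (A : Set V) (n : ℕ) (u v : V) : Prop :=
  ∃ p : G.Walk u v, p.length ≤ n ∧ ∀ x ∈ p.support, x ∈ A

variable {G : SimpleGraph V} {A B : Set V} {m n : ℕ} {u v w : V}

lemma WalkIn.right_mem (h : WalkIn G A n u v) : v ∈ A := by
  obtain ⟨p, -, hp⟩ := h
  exact hp _ p.end_mem_support

lemma WalkIn.refl (hu : u ∈ A) : WalkIn G A n u u :=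
  ⟨.nil, by simp, by simpa using hu⟩

lemma WalkIn.symm (h : WalkIn G A n u v) : WalkIn G A n v u := by
  obtain ⟨p, hn, hp⟩ := h
  exact ⟨p.reverse, by simpa using hn, by simpa using hp⟩

lemma WalkIn.trans (h : WalkIn G A m u v) (h' : WalkIn G A n v w) : WalkIn G A (m + n) u w := by
  obtain ⟨p, hn, hp⟩ := h
  obtain ⟨q, hm, hq⟩ := h'
  refine ⟨p.append q, by rw [Walk.length_append]; omega, fun x hx => ?_⟩
  rw [Walk.mem_support_append_iff] at hx
  exact hx.elim (hp x) (hq x)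

lemma WalkIn.mono (h : WalkIn G A m u v) (hAB : A ⊆ B) (hmn : m ≤ n) : WalkIn G B n u v := by
  obtain ⟨p, hn, hp⟩ := h
  exact ⟨p, hn.trans hmn, fun x hx => hAB (hp x hx)⟩

lemma WalkIn.of_adj (h : G.Adj u v) (hu : u ∈ A) (hv : v ∈ A) : WalkIn G A 1 u v :=
  ⟨h.toWalk, by simp, by simp [hu, hv]⟩

lemma WalkIn.within_reach (h : WalkIn G A n u v) : WalkIn G {y | WalkIn G A n u y} n u v := by
  obtain ⟨p, hn, hp⟩ := h
  refine ⟨p, hn, fun x hx => ⟨p.takeUntil x hx, ?_, fun y hy => ?_⟩⟩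
  · exact (p.length_takeUntil_le_length hx).trans hn
  · exact hp y (p.support_takeUntil_subset_support hx hy)

lemma WalkIn.map {G' : SimpleGraph W} (h : WalkIn G A n u v) (f : V → W)
    (hf : ∀ a b, G.Adj a b → G'.Adj (f a) (f b)) : WalkIn G' (f '' A) n (f u) (f v) := by
  obtain ⟨p, hn, hp⟩ := h
  refine ⟨p.map ⟨f, fun {a b} h => hf a b h⟩, by simpa using hn, fun x hx => ?_⟩
  rw [Walk.support_map, List.mem_map] at hx
  obtain ⟨y, hy, rfl⟩ := hx
  exact ⟨y, hp y hy, rfl⟩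

lemma hasRadiusLE_induce_iff {r : ℕ} :
    hasRadiusLE (G.induce A) r ↔ ∃ u ∈ A, ∀ v ∈ A, WalkIn G A r u v := by
  constructor
  · rintro ⟨u, hu⟩
    refine ⟨u, u.2, fun v hv => ?_⟩
    obtain ⟨p, hp⟩ := hu ⟨v, hv⟩
    refine ⟨p.map (Embedding.induce A).toHom, (Walk.length_map _ p).le.trans hp, fun x hx => ?_⟩
    obtain ⟨y, -, rfl⟩ := List.mem_map.mp ((Walk.support_map (Embedding.induce A).toHom p) ▸ hx)
    exact y.2
  · rintro ⟨u, hu, h⟩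
    refine ⟨⟨u, hu⟩, fun v => ?_⟩
    obtain ⟨p, hn, hp⟩ := h v v.2
    refine ⟨p.induce A hp, ?_⟩
    rw [← Walk.length_map (Embedding.induce A).toHom, Walk.map_induce]
    exact hn

/-- A walk from `v ∉ Q` to `u ∈ Q` has an initial segment avoiding `Q` followed by an edge
into `Q`. -/
lemma exists_first_hit {Q : Set V} (p : G.Walk v u) (hv : v ∉ Q) (hu : u ∈ Q) :
    ∃ w, ∃ x ∈ Q, x ∈ p.support ∧ G.Adj w x ∧ ∃ n, n + 1 ≤ p.length ∧ WalkIn G Qᶜ n v w := by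
  induction p with
  | nil => exact absurd hu hv
  | @cons a b c h p ih =>
    by_cases hb : b ∈ Q
    · exact ⟨a, b, hb, by simp, h, 0, by simp, .refl hv⟩
    · obtain ⟨w, x, hx, hxp, hwx, n, hn, hw⟩ := ih hb hu
      refine ⟨w, x, hx, by simp [hxp], hwx, n + 1, by simpa using hn, ?_⟩
      rw [add_comm]
      exact (WalkIn.of_adj h hv hb).trans hw

end Walks

section Minors

variable {U : Type}

lemma isDepthMinor_iff {r : ℕ} {H : SimpleGraph W} {G : SimpleGraph V} :
    IsDepthMinor r H G ↔ ∃ (φ : W → Set V) (c : W → V),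
      (∀ w, c w ∈ φ w ∧ ∀ x ∈ φ w, WalkIn G (φ w) r (c w) x) ∧
      (∀ w w' x, x ∈ φ w → x ∈ φ w' → w = w') ∧
      ∀ a b, H.Adj a b → ∃ u ∈ φ a, ∃ v ∈ φ b, G.Adj u v := by
  constructor
  · rintro ⟨φ, h1, h2, h3⟩
    simp only [hasRadiusLE_induce_iff] at h1
    choose c hc hc' using h1
    refine ⟨φ, c, fun w => ⟨hc w, hc' w⟩, fun w w' x hx hx' => ?_, h3⟩
    by_contra hne
    exact Set.disjoint_left.mp (h2 hne) hx hx'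
  · rintro ⟨φ, c, h1, h2, h3⟩
    refine ⟨φ, fun w => hasRadiusLE_induce_iff.mpr ⟨c w, h1 w⟩, fun w w' hne => ?_, h3⟩
    exact Set.disjoint_left.mpr fun x hx hx' => hne (h2 w w' x hx hx')

lemma _root_.IsDepthMinor.mono_depth {r s : ℕ} {H : SimpleGraph W} {G : SimpleGraph V}
    (h : IsDepthMinor r H G) (hrs : r ≤ s) : IsDepthMinor s H G := by
  rw [isDepthMinor_iff] at h ⊢
  obtain ⟨φ, c, h1, h2, h3⟩ := h
  exact ⟨φ, c, fun w => ⟨(h1 w).1, fun x hx => ((h1 w).2 x hx).mono subset_rfl hrs⟩, h2, h3⟩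

lemma _root_.IsDepthMinor.comap {r : ℕ} {H : SimpleGraph W} {H' : SimpleGraph U} {G : SimpleGraph V}
    (h : IsDepthMinor r H G) (f : U → W) (hf : Function.Injective f)
    (hadj : ∀ a b, H'.Adj a b → H.Adj (f a) (f b)) : IsDepthMinor r H' G := by
  obtain ⟨φ, h1, h2, h3⟩ := h
  exact ⟨φ ∘ f, fun w => h1 _, fun a b hab => h2 (hf.ne hab), fun a b hab => h3 _ _ (hadj a b hab)⟩

lemma _root_.IsDepthMinor.map {r : ℕ} {H : SimpleGraph W} {G : SimpleGraph V} {G' : SimpleGraph U}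
    (h : IsDepthMinor r H G) (f : V → U) (hf : Function.Injective f)
    (hadj : ∀ a b, G.Adj a b → G'.Adj (f a) (f b)) : IsDepthMinor r H G' := by
  rw [isDepthMinor_iff] at h ⊢
  obtain ⟨φ, c, h1, h2, h3⟩ := h
  refine ⟨fun w => f '' φ w, fun w => f (c w), fun w => ⟨⟨_, (h1 w).1, rfl⟩, ?_⟩, ?_, ?_⟩
  · rintro _ ⟨x, hx, rfl⟩
    exact ((h1 w).2 x hx).map f hadj
  · rintro w w' _ ⟨x, hx, rfl⟩ ⟨y, hy, hxy⟩
    obtain rfl := hf hxy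
    exact h2 w w' y hx hy
  · intro a b hab
    obtain ⟨u, hu, v, hv, huv⟩ := h3 a b hab
    exact ⟨f u, ⟨u, hu, rfl⟩, f v, ⟨v, hv, rfl⟩, hadj _ _ huv⟩

lemma _root_.IsDepthMinor.trans {a b : ℕ} {K : SimpleGraph U} {F : SimpleGraph W} {G : SimpleGraph V}
    (h : IsDepthMinor a K F) (h' : IsDepthMinor b F G) :
    IsDepthMinor ((2 * b + 1) * a + b) K G := by
  rw [isDepthMinor_iff] at *
  obtain ⟨ψ, d, g1, g2, g3⟩ := h
  obtain ⟨φ, c, h1, h2, h3⟩ := h'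
  have lift : ∀ (A : Set W) (x y : W) (p : F.Walk x y), (∀ z ∈ p.support, z ∈ A) →
      WalkIn G (⋃ z ∈ A, φ z) ((2 * b + 1) * p.length) (c x) (c y) := by
    intro A x y p
    have sub : ∀ z ∈ A, φ z ⊆ ⋃ z ∈ A, φ z := fun z hz => Set.subset_biUnion_of_mem hz
    induction p with
    | nil =>
      intro hp
      exact .refl (sub _ (hp _ (by simp)) (h1 _).1)
    | @cons x y z hxy p ih =>
      intro hp
      have hx : x ∈ A := hp _ (by simp)
      have hy : y ∈ A := hp _ (by simp)
      have ih := ih fun z hz => hp z (by simp [hz])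
      obtain ⟨u, hu, v, hv, huv⟩ := h3 x y hxy
      have e1 := ((h1 x).2 u hu).mono (sub x hx) le_rfl
      have e2 := ((h1 y).2 v hv).mono (sub y hy) le_rfl
      have e3 := WalkIn.of_adj huv (sub x hx hu) (sub y hy hv)
      refine (((e1.trans e3).trans e2.symm).trans ih).mono subset_rfl ?_
      rw [Walk.length_cons]
      linarith
  refine ⟨fun w => ⋃ z ∈ ψ w, φ z, fun w => c (d w), fun w => ⟨?_, fun x hx => ?_⟩, ?_, ?_⟩
  · exact Set.mem_biUnion (g1 w).1 (h1 _).1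
  · obtain ⟨z, hz, hxz⟩ := Set.mem_iUnion₂.mp hx
    obtain ⟨p, hp, hpA⟩ := (g1 w).2 z hz
    refine ((lift _ _ _ p hpA).trans (((h1 z).2 x hxz).mono
      (Set.subset_biUnion_of_mem hz) le_rfl)).mono subset_rfl ?_
    gcongr
  · intro w w' x hx hx'
    obtain ⟨z, hz, hxz⟩ := Set.mem_iUnion₂.mp hx
    obtain ⟨z', hz', hxz'⟩ := Set.mem_iUnion₂.mp hx'
    obtain rfl := h2 _ _ _ hxz hxz'
    exact g2 _ _ _ hz hz'
  · intro x y hxy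
    obtain ⟨u, hu, v, hv, huv⟩ := g3 x y hxy
    obtain ⟨u', hu', v', hv', huv'⟩ := h3 u v huv
    exact ⟨u', Set.mem_biUnion hu hu', v', Set.mem_biUnion hv hv', huv'⟩

end Minors

section AdjPairs

/-- The number of ordered pairs of adjacent vertices in `X`. -/
noncomputable def adjPairs (G : SimpleGraph V) (X : Finset V) : ℕ :=
  ((X ×ˢ X).filter fun p => G.Adj p.1 p.2).card

/-- The number of neighbours of `v` in `X`. -/
noncomputable def degIn (G : SimpleGraph V) (X : Finset V) (v : V) : ℕ :=
  (X.filter fun w => G.Adj v w).card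

lemma adjPairs_eq_sum (G : SimpleGraph V) (X : Finset V) :
    adjPairs G X = ∑ v ∈ X, degIn G X v := by
  unfold adjPairs degIn
  rw [Finset.card_filter, Finset.sum_product]
  exact Finset.sum_congr rfl fun v _ => (Finset.card_filter _ _).symm

lemma degIn_mono (G : SimpleGraph V) {X Y : Finset V} (h : X ⊆ Y) (v : V) :
    degIn G X v ≤ degIn G Y v :=
  Finset.card_le_card (Finset.filter_subset_filter _ h)

lemma adjPairs_le_sq (G : SimpleGraph V) (X : Finset V) : adjPairs G X ≤ X.card * X.card := by
  rw [← Finset.card_product]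
  exact Finset.card_filter_le _ _

lemma adjPairs_induce (G : SimpleGraph V) (X : Finset V) (Y : Finset (X : Set V)) :
    adjPairs (G.induce (X : Set V)) Y = adjPairs G (Y.map (Function.Embedding.subtype _)) := by
  unfold adjPairs
  refine Finset.card_bij (fun p _ => (p.1.1, p.2.1)) ?_ ?_ ?_
  · rintro ⟨⟨a, ha⟩, ⟨b, hb⟩⟩ h
    simp only [Finset.mem_filter, Finset.mem_product, comap_adj, Function.Embedding.subtype_apply,
      Finset.mem_map] at h ⊢
    exact ⟨⟨⟨_, h.1.1, rfl⟩, ⟨_, h.1.2, rfl⟩⟩, h.2⟩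
  · rintro ⟨⟨a, ha⟩, ⟨b, hb⟩⟩ _ ⟨⟨a', ha'⟩, ⟨b', hb'⟩⟩ _ h
    simpa using h
  · rintro ⟨a, b⟩ h
    simp only [Finset.mem_filter, Finset.mem_product, Function.Embedding.subtype_apply,
      Finset.mem_map] at h
    obtain ⟨⟨⟨a, ha, rfl⟩, ⟨b, hb, rfl⟩⟩, hab⟩ := h
    exact ⟨(a, b), by simpa using ⟨⟨ha, hb⟩, hab⟩, rfl⟩

lemma adjPairs_induce_univ (G : SimpleGraph V) (X : Finset V) :
    adjPairs (G.induce (X : Set V)) Finset.univ = adjPairs G X := by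
  rw [adjPairs_induce]
  congr 1
  ext x
  simp

/-- Greedy bound: bounded degree inside `Y` yields a large independent subset. -/
lemma exists_indep (G : SimpleGraph V) (Y : Finset V) (d : ℕ)
    (h : ∀ v ∈ Y, degIn G Y v + 1 ≤ d) :
    ∃ I ⊆ Y, (∀ a ∈ I, ∀ b ∈ I, ¬ G.Adj a b) ∧ Y.card ≤ I.card * d := by
  let P : Finset (Finset V) := Y.powerset.filter fun I => ∀ a ∈ I, ∀ b ∈ I, ¬ G.Adj a b
  obtain ⟨I, hI, hmax⟩ := P.exists_max_image Finset.card ⟨∅, by simp [P]⟩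
  simp only [P, Finset.mem_filter, Finset.mem_powerset] at hI hmax
  refine ⟨I, hI.1, hI.2, ?_⟩
  have cover : Y ⊆ I.biUnion fun v => insert v (Y.filter fun w => G.Adj v w) := by
    intro x hx
    by_contra hcon
    simp only [Finset.mem_biUnion, Finset.mem_insert, Finset.mem_filter, not_exists, not_and,
      not_or] at hcon
    have hxI : x ∉ I := fun hxI => (hcon x hxI).1 rfl
    have := hmax (insert x I) ⟨Finset.insert_subset hx hI.1, ?_⟩
    · rw [Finset.card_insert_of_notMem hxI] at this
      omega
    · intro a ha b hb hab
      rcases Finset.mem_insert.mp ha with rfl | ha' <;> rcases Finset.mem_insert.mp hb with rfl | hb'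
      · exact G.loopless.irrefl _ hab
      · exact (hcon b hb').2 hx hab.symm
      · exact (hcon a ha').2 hx hab
      · exact hI.2 a ha' b hb' hab
  calc Y.card ≤ _ := Finset.card_le_card cover
    _ ≤ I.card * d := Finset.card_biUnion_le_card_mul _ _ _ fun v hv =>
      (Finset.card_insert_le _ _).trans (h v (hI.1 hv))

end AdjPairs

section PathSystems

/-- Pairwise disjoint sets `I e` of at most `L` vertices outside `S`, one for each pair `e ∈ E` of
distinct elements of `S`, such that `I e` contains the interior of a path joining the pair. -/
structure PathSystem (G : SimpleGraph V) (S : Finset V) (L : ℕ) (E : Finset (V × V))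
    (I : V × V → Finset V) : Prop where
  mem : ∀ e ∈ E, e.1 ∈ S ∧ e.2 ∈ S ∧ e.1 ≠ e.2
  notMem : ∀ e ∈ E, ∀ x ∈ I e, x ∉ S
  disj : ∀ e ∈ E, ∀ f ∈ E, ∀ x ∈ I e, x ∈ I f → e = f
  card_le : ∀ e ∈ E, (I e).card ≤ L
  walk : ∀ e ∈ E, ∀ x ∈ I e, WalkIn G (insert e.1 (I e : Set V)) L e.1 x
  adj : ∀ e ∈ E, ∃ w ∈ insert e.1 (I e : Set V), G.Adj w e.2

variable {G : SimpleGraph V} {S : Finset V} {L : ℕ} {E : Finset (V × V)} {I : V × V → Finset V}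

lemma PathSystem.exists_insert (h : PathSystem G S L E I) {u v : V} (hu : u ∈ S) (hv : v ∈ S)
    (huv : u ≠ v) (hE : (u, v) ∉ E)
    (hw : WalkIn G ({u, v} ∪ {x | x ∉ S ∧ ∀ e ∈ E, x ∉ I e}) (L + 1) u v) :
    ∃ I', PathSystem G S L (insert (u, v) E) I' := by
  obtain ⟨p, hpL, hp⟩ := hw
  obtain ⟨w, x, hx, hxp, hwx, n, hn, q, hqn, hq⟩ :=
    exists_first_hit (Q := {v} ∪ ({u, v} ∪ {x | x ∉ S ∧ ∀ e ∈ E, x ∉ I e})ᶜ) p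
      (by simp [huv]) (by simp)
  obtain rfl : x = v := by
    rcases hx with hx | hx
    · exact hx
    · exact absurd (hp x hxp) hx
  have hq' : ∀ y ∈ q.support, y ≠ x ∧ (y ≠ u → y ∉ S ∧ ∀ e ∈ E, y ∉ I e) := by
    intro y hy
    have := hq y hy
    simp only [Set.mem_compl_iff, Set.mem_union, not_or, Set.mem_insert_iff,
      Set.mem_singleton_iff, Set.mem_ofPred_eq] at this
    tauto
  let J : Finset V := q.support.toFinset.erase u
  have hJ : ∀ y, y ∈ J ↔ y ≠ u ∧ y ∈ q.support := by simp [J]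
  have hins : insert u (J : Set V) = {y | y ∈ q.support} := by
    ext y
    simp only [Set.mem_insert_iff, Finset.mem_coe, hJ, Set.mem_ofPred_eq]
    constructor
    · rintro (rfl | h)
      · exact q.start_mem_support
      · exact h.2
    · tauto
  have hne : ∀ e ∈ E, e ≠ (u, x) := fun e he h => hE (h ▸ he)
  refine ⟨Function.update I (u, x) J, ⟨?_, ?_, ?_, ?_, ?_, ?_⟩⟩
  · rintro e he
    rcases Finset.mem_insert.mp he with rfl | he
    · exact ⟨hu, hv, huv⟩
    · exact h.mem e he
  · rintro e he y hy
    rcases Finset.mem_insert.mp he with rfl | he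
    · rw [Function.update_self, hJ] at hy
      exact ((hq' y hy.2).2 hy.1).1
    · rw [Function.update_of_ne (hne e he)] at hy
      exact h.notMem e he y hy
  · rintro e he f hf y hye hyf
    rcases Finset.mem_insert.mp he with rfl | he <;> rcases Finset.mem_insert.mp hf with rfl | hf
    · rfl
    · rw [Function.update_self, hJ] at hye
      rw [Function.update_of_ne (hne f hf)] at hyf
      exact absurd hyf (((hq' y hye.2).2 hye.1).2 f hf)
    · rw [Function.update_self, hJ] at hyf
      rw [Function.update_of_ne (hne e he)] at hye
      exact absurd hye (((hq' y hyf.2).2 hyf.1).2 e he)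
    · rw [Function.update_of_ne (hne e he)] at hye
      rw [Function.update_of_ne (hne f hf)] at hyf
      exact h.disj e he f hf y hye hyf
  · rintro e he
    rcases Finset.mem_insert.mp he with rfl | he
    · rw [Function.update_self, Finset.card_erase_of_mem (by simp)]
      have := q.support.toFinset_card_le
      rw [Walk.length_support] at this
      omega
    · rw [Function.update_of_ne (hne e he)]
      exact h.card_le e he
  · rintro e he y hy
    rcases Finset.mem_insert.mp he with rfl | he
    · rw [Function.update_self] at hy ⊢
      have hy' := ((hJ y).mp hy).2
      rw [hins]
      refine ⟨q.takeUntil y hy', ?_, fun z hz => q.support_takeUntil_subset_support hy' hz⟩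
      have := q.length_takeUntil_le_length hy'
      omega
    · rw [Function.update_of_ne (hne e he)] at hy ⊢
      exact h.walk e he y hy
  · rintro e he
    rcases Finset.mem_insert.mp he with rfl | he
    · rw [Function.update_self, hins]
      exact ⟨w, q.end_mem_support, hwx⟩
    · rw [Function.update_of_ne (hne e he)]
      exact h.adj e he

lemma PathSystem.isDepthMinor (h : PathSystem G S L E I) (H : SimpleGraph (S : Set V))
    (hH : ∀ a b, H.Adj a b → (a.1, b.1) ∈ E ∨ (b.1, a.1) ∈ E) : IsDepthMinor L H G := by
  rw [isDepthMinor_iff]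
  let φ : ↥(S : Set V) → Set V := fun u => {x | x = u.1 ∨ ∃ e ∈ E, e.1 = u.1 ∧ x ∈ I e}
  have hsub : ∀ (u : (S : Set V)), ∀ e ∈ E, e.1 = u.1 → insert e.1 (I e : Set V) ⊆ φ u := by
    rintro u e he heu x (rfl | hx)
    · exact Or.inl heu
    · exact Or.inr ⟨e, he, heu, hx⟩
  refine ⟨φ, fun u => u.1, fun u => ⟨Or.inl rfl, ?_⟩, ?_, ?_⟩
  · rintro x (rfl | ⟨e, he, heu, hxe⟩)
    · exact .refl (Or.inl rfl)
    · change WalkIn G (φ u) L u.1 x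
      rw [← heu]
      exact (h.walk e he x hxe).mono (hsub u e he heu) le_rfl
  · rintro u v x (hxu | ⟨e, he, heu, hxe⟩) (hxv | ⟨f, hf, hfv, hxf⟩)
    · exact Subtype.ext (hxu.symm.trans hxv)
    · exact absurd (hxu ▸ u.2) (h.notMem f hf x hxf)
    · exact absurd (hxv ▸ v.2) (h.notMem e he x hxe)
    · obtain rfl := h.disj e he f hf x hxe hxf
      exact Subtype.ext (heu.symm.trans hfv)
  · have key : ∀ a b : (S : Set V), (a.1, b.1) ∈ E → ∃ w ∈ φ a, G.Adj w b.1 := by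
      intro a b hab
      obtain ⟨w, hw, hwb⟩ := h.adj _ hab
      exact ⟨w, hsub a _ hab rfl hw, hwb⟩
    rintro a b hab
    rcases hH a b hab with hab | hab
    · obtain ⟨w, hw, hwb⟩ := key a b hab
      exact ⟨w, hw, b, Or.inl rfl, hwb⟩
    · obtain ⟨w, hw, hwb⟩ := key b a hab
      exact ⟨a, Or.inl rfl, w, hw, hwb.symm⟩

/-- A maximal system of short disjoint connections between elements of `S`. -/
lemma exists_maximal_connections [Fintype V] (G : SimpleGraph V) (S : Finset V) (L : ℕ) :
    ∃ (H : SimpleGraph V) (M : Finset V), Disjoint M S ∧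
      M.card ≤ L * adjPairs H S ∧ IsDepthMinor L (H.induce (S : Set V)) G ∧
      ∀ u ∈ S, ∀ v ∈ S, u ≠ v →
        WalkIn G ({u, v} ∪ {x | x ∉ S ∧ x ∉ M}) (L + 1) u v → H.Adj u v := by
  let P : Finset (Finset (V × V)) := Finset.univ.filter fun E => ∃ I, PathSystem G S L E I
  have hP : P.Nonempty :=
    ⟨∅, by simpa [P] using ⟨fun _ => ∅, ⟨by simp, by simp, by simp, by simp, by simp, by simp⟩⟩⟩
  obtain ⟨E, hE, hmax⟩ := P.exists_max_image Finset.card hP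
  simp only [P, Finset.mem_filter, Finset.mem_univ, true_and] at hE hmax
  obtain ⟨I, hI⟩ := hE
  let H : SimpleGraph V := SimpleGraph.fromRel fun u v => (u, v) ∈ E
  refine ⟨H, E.biUnion I, ?_, ?_, ?_, ?_⟩
  · rw [Finset.disjoint_biUnion_left]
    exact fun e he => Finset.disjoint_left.mpr (hI.notMem e he)
  · calc (E.biUnion I).card ≤ E.card * L := Finset.card_biUnion_le_card_mul _ _ _ hI.card_le
      _ ≤ adjPairs H S * L := by
        gcongr
        refine Finset.card_le_card fun e he => ?_
        obtain ⟨h1, h2, h3⟩ := hI.mem e he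
        simp only [Finset.mem_filter, Finset.mem_product]
        exact ⟨⟨h1, h2⟩, h3, Or.inl he⟩
      _ = _ := mul_comm _ _
  · exact hI.isDepthMinor _ fun a b hab => hab.2
  · intro u hu v hv huv hw
    refine ⟨huv, Or.inl ?_⟩
    by_contra hE
    have hsub : ({u, v} ∪ {x | x ∉ S ∧ x ∉ E.biUnion I} : Set V) ⊆
        {u, v} ∪ {x | x ∉ S ∧ ∀ e ∈ E, x ∉ I e} :=
      Set.union_subset_union_right _ fun x hx => ⟨hx.1, fun e he hxe =>
        hx.2 (Finset.mem_biUnion.mpr ⟨e, he, hxe⟩)⟩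
    have := hmax _ (hI.exists_insert hu hv huv hE (hw.mono hsub le_rfl))
    rw [Finset.card_insert_of_notMem hE] at this
    omega

/-- Robustly connected terminals are the centres of a shallow clique minor. -/
lemma isDepthMinor_top_of_robust [Fintype V] (G : SimpleGraph V) (S : Finset V) (L : ℕ)
    (h : ∀ u ∈ S, ∀ v ∈ S, u ≠ v → ∀ B : Finset V, B.card ≤ S.card + L * (S.card * S.card) →
      u ∉ B → v ∉ B → WalkIn G {x | x ∉ B} (L + 1) u v) :
    IsDepthMinor L (⊤ : SimpleGraph (Fin S.card)) G := by
  obtain ⟨H, M, hMS, hM, hmin, hconn⟩ := exists_maximal_connections G S L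
  refine hmin.comap (fun i => ⟨(S.equivFin.symm i).1, (S.equivFin.symm i).2⟩) ?_ ?_
  · intro i j hij
    simpa [Subtype.ext_iff] using hij
  · intro i j hij
    have hne : (S.equivFin.symm i).1 ≠ (S.equivFin.symm j).1 := by
      intro heq
      exact hij (S.equivFin.symm.injective (Subtype.ext heq))
    have hu := (S.equivFin.symm i).2
    have hv := (S.equivFin.symm j).2
    change H.Adj (S.equivFin.symm i).1 (S.equivFin.symm j).1
    generalize (S.equivFin.symm i).1 = u at *
    generalize (S.equivFin.symm j).1 = v at *
    refine hconn u hu v hv hne ((h u hu v hv hne ((S \ {u, v}) ∪ M) ?_ ?_ ?_).mono ?_ le_rfl)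
    · refine (Finset.card_union_le _ _).trans (add_le_add (Finset.card_le_card Finset.sdiff_subset) ?_)
      exact hM.trans (Nat.mul_le_mul le_rfl (adjPairs_le_sq H S))
    · have := Finset.disjoint_right.mp hMS hu
      simp [this]
    · have := Finset.disjoint_right.mp hMS hv
      simp [this]
    · intro x hx
      simp only [Set.mem_ofPred_eq, Finset.mem_union, Finset.mem_sdiff, not_or, Set.mem_union,
        Set.mem_insert_iff, Set.mem_singleton_iff, Finset.mem_insert, Finset.mem_singleton] at hx ⊢
      tauto

end PathSystems

section Separators

/-- The size of the separators obtained from density bound `c` and distance `l`. -/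
def sepBound (c l : ℕ) : ℕ := 2 * c + c * (1 + 4 * l * c * (2 * c + 1))

/-- If shallow minors of `G` are sparse, then in every vertex set `S` some vertex is separated
from the rest of `S` by few vertices, as far as short walks are concerned. -/
lemma exists_small_separator [Fintype V] (G : SimpleGraph V) (l c : ℕ)
    (dens : ∀ (N : Type) [Fintype N] (F : SimpleGraph N), IsDepthMinor (2 * l) F G →
      adjPairs F Finset.univ ≤ c * Fintype.card N)
    (S : Finset V) (hS : S.Nonempty) :
    ∃ v ∈ S, ∃ Z : Finset V, Z.card ≤ sepBound c l ∧ v ∉ Z ∧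
      ∀ u ∈ S, u ≠ v → ∀ p : G.Walk v u, p.length ≤ l → ∃ z ∈ Z, z ∈ p.support := by
  by_contra hcon
  obtain ⟨H, M, hMS, hM, hmin, hconn⟩ := exists_maximal_connections G S (2 * l)
  have hHS : adjPairs H S ≤ c * S.card := by
    have := dens _ _ hmin
    rw [adjPairs_induce_univ] at this
    simpa using this
  let Low := S.filter fun v => degIn H S v ≤ 2 * c
  have hLow : S.card ≤ 2 * Low.card := by
    have h1 : (S.filter fun v => ¬ degIn H S v ≤ 2 * c).card * (2 * c + 1) ≤ c * S.card := by
      refine le_trans ?_ hHS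
      rw [adjPairs_eq_sum, ← smul_eq_mul]
      refine (Finset.card_nsmul_le_sum _ _ _ fun v hv => ?_).trans
        (Finset.sum_le_sum_of_subset (Finset.filter_subset (fun v => ¬ degIn H S v ≤ 2 * c) S))
      have := (Finset.mem_filter.mp hv).2
      omega
    have h2 := Finset.card_filter_add_card_filter_not (s := S) fun v => degIn H S v ≤ 2 * c
    change Low.card + _ = _ at h2
    by_contra h3
    nlinarith
  obtain ⟨I, hI, hIind, hLowI⟩ := exists_indep H Low (2 * c + 1) fun v hv => by
    have := degIn_mono H (Finset.filter_subset (fun v => degIn H S v ≤ 2 * c) S) v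
    have h2 := (Finset.mem_filter.mp hv).2
    change degIn H Low v ≤ _ at this
    omega
  have hIS : ∀ v ∈ I, v ∈ S ∧ degIn H S v ≤ 2 * c := fun v hv => Finset.mem_filter.mp (hI hv)
  let Q : V → Set V := fun v => {x | x ≠ v ∧ (x ∈ S ∨ x ∈ M)}
  have hQ : ∀ v, v ∈ (Q v)ᶜ := fun v h => h.1 rfl
  have hQsub : ∀ v, (Q v)ᶜ ⊆ {v} ∪ {x | x ∉ S ∧ x ∉ M} := by
    intro v x hx
    by_cases hxv : x = v
    · exact Or.inl hxv
    · exact Or.inr (not_or.mp fun h => hx ⟨hxv, h⟩)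
  let A : V → Finset V := fun v => Finset.univ.filter fun x =>
    x ∈ Q v ∧ ∃ w n, n + 1 ≤ l ∧ WalkIn G (Q v)ᶜ n v w ∧ G.Adj w x
  have hA : ∀ v x, x ∈ A v ↔
      x ∈ Q v ∧ ∃ w n, n + 1 ≤ l ∧ WalkIn G (Q v)ᶜ n v w ∧ G.Adj w x := by
    intro v x
    simp [A]
  have hAcard : ∀ v ∈ S, sepBound c l < (A v).card := by
    intro v hv
    by_contra hle
    refine hcon ⟨v, hv, A v, not_lt.mp hle, fun h => ((hA v v).mp h).1.1 rfl, ?_⟩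
    intro u hu huv p hp
    obtain ⟨w, x, hx, hxp, hwx, n, hn, hw⟩ :=
      exists_first_hit (Q := Q v) p (hQ v) ⟨huv, Or.inl hu⟩
    exact ⟨x, (hA v x).mpr ⟨hx, w, n, hn.trans hp, hw, hwx⟩, hxp⟩
  have hAM : ∀ v ∈ I, c * (1 + 4 * l * c * (2 * c + 1)) + 1 ≤ (A v ∩ M).card := by
    intro v hv
    have h1 : A v ⊆ (A v ∩ M) ∪ (S.filter fun w => H.Adj v w) := by
      intro x hx
      obtain ⟨hxQ, w, n, hn, hw, hwx⟩ := (hA v x).mp hx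
      rcases hxQ.2 with hxS | hxM
      · refine Finset.mem_union_right _ (Finset.mem_filter.mpr ⟨hxS, ?_⟩)
        refine hconn v (hIS v hv).1 x hxS hxQ.1.symm ?_
        have hsub : (Q v)ᶜ ⊆ {v, x} ∪ {x | x ∉ S ∧ x ∉ M} :=
          (hQsub v).trans (Set.union_subset_union_left _ (by simp))
        exact ((hw.mono hsub le_rfl).trans (WalkIn.of_adj hwx (hsub hw.right_mem)
          (by simp))).mono subset_rfl (by omega)
      · exact Finset.mem_union_left _ (Finset.mem_inter.mpr ⟨hx, hxM⟩)
    have h2 := (Finset.card_le_card h1).trans (Finset.card_union_le _ _)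
    have h3 := hAcard v (hIS v hv).1
    have h4 := (hIS v hv).2
    unfold degIn at h4
    unfold sepBound at h3
    omega
  let F : SimpleGraph (I ⊕ M) := SimpleGraph.fromRel fun a b =>
    ∃ (v : I) (m : M), a = .inl v ∧ b = .inr m ∧ m.1 ∈ A v.1
  have hF : IsDepthMinor (2 * l) F G := by
    have : IsDepthMinor l F G := by
      rw [isDepthMinor_iff]
      let φ : I ⊕ M → Set V := Sum.elim (fun v => {y | WalkIn G (Q v.1)ᶜ l v.1 y}) fun m => {m.1}
      have hdisj : ∀ (v : I) (m : M) x, x ∈ φ (.inl v) → x ∈ φ (.inr m) → False := by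
        rintro v m x (hx : WalkIn _ _ _ _ _) rfl
        have := hQsub _ hx.right_mem
        rcases this with h | h
        · exact Finset.disjoint_left.mp hMS m.2 (h ▸ (hIS v.1 v.2).1)
        · exact h.2 m.2
      refine ⟨φ, Sum.elim (fun v => v.1) fun m => m.1, ?_, ?_, ?_⟩
      · rintro (v | m)
        · exact ⟨WalkIn.refl (hQ v.1), fun x hx => WalkIn.within_reach hx⟩
        · refine ⟨rfl, ?_⟩
          rintro x rfl
          exact WalkIn.refl rfl
      · rintro (v | m) (v' | m') x hx hx'
        · by_contra hne
          have hne' : v.1 ≠ v'.1 := fun h => hne (by rw [Subtype.ext h])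
          refine hIind v.1 v.2 v'.1 v'.2 (hconn _ (hIS _ v.2).1 _ (hIS _ v'.2).1 hne' ?_)
          have e1 : WalkIn G ({v.1, v'.1} ∪ {x | x ∉ S ∧ x ∉ M}) l v.1 x := WalkIn.mono hx
            ((hQsub v.1).trans (Set.union_subset_union_left _ (by simp))) le_rfl
          have e2 : WalkIn G ({v.1, v'.1} ∪ {x | x ∉ S ∧ x ∉ M}) l v'.1 x := WalkIn.mono hx'
            ((hQsub v'.1).trans (Set.union_subset_union_left _ (by simp))) le_rfl
          exact (e1.trans e2.symm).mono subset_rfl (by omega)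
        · exact (hdisj v m' x hx hx').elim
        · exact (hdisj v' m x hx' hx).elim
        · have : m = m' := Subtype.ext (Eq.trans (Eq.symm hx) hx')
          rw [this]
      · have key : ∀ (v : I) (m : M), m.1 ∈ A v.1 →
            ∃ u ∈ φ (.inl v), G.Adj u m.1 := by
          intro v m hm
          obtain ⟨-, w, n, hn, hw, hwx⟩ := (hA _ _).mp hm
          exact ⟨w, hw.mono subset_rfl (by omega), hwx⟩
        rintro a b ⟨-, ⟨v, m, rfl, rfl, hm⟩ | ⟨v, m, rfl, rfl, hm⟩⟩
        · obtain ⟨u, hu, hum⟩ := key v m hm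
          exact ⟨u, hu, m.1, rfl, hum⟩
        · obtain ⟨u, hu, hum⟩ := key v m hm
          exact ⟨m.1, rfl, u, hu, hum.symm⟩
    exact this.mono_depth (by omega)
  have h1 := dens _ F hF
  rw [Fintype.card_sum, Fintype.card_coe, Fintype.card_coe, adjPairs_eq_sum,
    Fintype.sum_sum_type] at h1
  have h2 : I.card * (c * (1 + 4 * l * c * (2 * c + 1)) + 1) ≤
      ∑ v : I, degIn F Finset.univ (.inl v) := by
    rw [← Fintype.card_coe I, ← Finset.card_univ, ← smul_eq_mul]
    refine Finset.card_nsmul_le_sum _ _ _ fun v _ => (hAM v.1 v.2).trans ?_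
    refine Finset.card_le_card_of_surjOn (Sum.elim (fun v => v.1) fun m => m.1) ?_
    intro m hm
    obtain ⟨hmA, hmM⟩ := Finset.mem_inter.mp (Finset.mem_coe.mp hm)
    refine ⟨.inr ⟨m, hmM⟩, ?_, rfl⟩
    rw [Finset.mem_coe, Finset.mem_filter]
    exact ⟨Finset.mem_univ _, by simp, Or.inl ⟨v, ⟨m, hmM⟩, rfl, rfl, hmA⟩⟩
  have hSpos := hS.card_pos
  have hIpos : 0 < I.card := by
    by_contra h
    have : I.card = 0 := by omega
    rw [this] at hLowI
    omega
  have h3 : M.card ≤ I.card * (4 * l * c * (2 * c + 1)) := by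
    calc M.card ≤ 2 * l * (c * S.card) := hM.trans (Nat.mul_le_mul le_rfl hHS)
      _ ≤ 2 * l * (c * (2 * (I.card * (2 * c + 1)))) := by
        gcongr
        omega
      _ = _ := by ring
  have h4 : c * M.card ≤ c * (I.card * (4 * l * c * (2 * c + 1))) := Nat.mul_le_mul le_rfl h3
  generalize 4 * l * c * (2 * c + 1) = X at *
  have h5 : I.card * (c * (1 + X) + 1) = c * I.card + c * (I.card * X) + I.card := by ring
  have h6 : c * (I.card + M.card) = c * I.card + c * M.card := by ring
  omega

end Separators

section Orders

/-- Iterating `exists_small_separator` gives a vertex ordering in which every vertex is separated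
from all smaller ones by few vertices. -/
lemma exists_rank {G : SimpleGraph V} (l K : ℕ)
    (h : ∀ S : Finset V, S.Nonempty → ∃ v ∈ S, ∃ Z : Finset V, Z.card ≤ K ∧ v ∉ Z ∧
      ∀ u ∈ S, u ≠ v → ∀ p : G.Walk v u, p.length ≤ l → ∃ z ∈ Z, z ∈ p.support)
    (S : Finset V) :
    ∃ f : V → ℕ, Set.InjOn f S ∧ (∀ v ∈ S, f v < S.card) ∧
      ∀ v ∈ S, ∃ Z : Finset V, Z.card ≤ K ∧ v ∉ Z ∧
        ∀ u ∈ S, f u < f v → ∀ p : G.Walk v u, p.length ≤ l → ∃ z ∈ Z, z ∈ p.support := by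
  induction hn : S.card generalizing S with
  | zero =>
    obtain rfl := Finset.card_eq_zero.mp hn
    exact ⟨fun _ => 0, by simp⟩
  | succ n ih =>
    obtain ⟨v, hv, Z, hZ, hvZ, hsep⟩ := h S (Finset.card_pos.mp (by omega))
    have hcard : (S.erase v).card = n := by rw [Finset.card_erase_of_mem hv]; omega
    obtain ⟨f, hinj, hlt, hf⟩ := ih _ hcard
    have hself : Function.update f v n v = n := Function.update_self ..
    have hother : ∀ u, u ≠ v → Function.update f v n u = f u := fun u hu =>
      Function.update_of_ne hu ..
    refine ⟨Function.update f v n, ?_, ?_, ?_⟩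
    · intro a ha b hb hab
      by_cases hav : a = v <;> by_cases hbv : b = v
      · rw [hav, hbv]
      · rw [hav, hself, hother b hbv] at hab
        have := hlt b (Finset.mem_erase.mpr ⟨hbv, hb⟩)
        omega
      · rw [hbv, hself, hother a hav] at hab
        have := hlt a (Finset.mem_erase.mpr ⟨hav, ha⟩)
        omega
      · rw [hother a hav, hother b hbv] at hab
        exact hinj (by simpa using ⟨ha, hav⟩) (by simpa using ⟨hb, hbv⟩) hab
    · intro u hu
      by_cases huv : u = v
      · rw [huv, hself]
        omega
      · rw [hother u huv]
        have := hlt u (Finset.mem_erase.mpr ⟨huv, hu⟩)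
        omega
    · intro w hw
      by_cases hwv : w = v
      · subst hwv
        refine ⟨Z, hZ, hvZ, fun u hu huw p hp => hsep u hu ?_ p hp⟩
        rintro rfl
        exact lt_irrefl _ huw
      · obtain ⟨Z', hZ', hwZ', hsep'⟩ := hf w (Finset.mem_erase.mpr ⟨hwv, hw⟩)
        refine ⟨Z', hZ', hwZ', fun u hu huw p hp => ?_⟩
        rw [hother w hwv] at huw
        have huv : u ≠ v := by
          rintro rfl
          rw [hself] at huw
          have := hlt w (Finset.mem_erase.mpr ⟨hwv, hw⟩)
          omega
        rw [hother u huv] at huw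
        exact hsep' u (Finset.mem_erase.mpr ⟨huv, hu⟩) huw p hp

/-- Vertices reachable from `v` by a walk of length at most `n` on which they have minimal rank. -/
noncomputable def weakReach [Fintype V] (G : SimpleGraph V) (f : V → ℕ) (n : ℕ) (v : V) :
    Finset V :=
  Finset.univ.filter fun u => WalkIn G {x | f u ≤ f x} n v u

lemma card_weakReach_le [Fintype V] {G : SimpleGraph V} {f : V → ℕ} {l K : ℕ}
    (hinj : Function.Injective f)
    (h : ∀ v, ∃ Z : Finset V, Z.card ≤ K ∧ v ∉ Z ∧
        ∀ u, f u < f v → ∀ p : G.Walk v u, p.length ≤ l → ∃ z ∈ Z, z ∈ p.support)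
    (n : ℕ) (hn : n ≤ l) (v : V) : (weakReach G f n v).card ≤ (K + 1) ^ n := by
  induction n generalizing v with
  | zero =>
    rw [pow_zero]
    refine Finset.card_le_one.mpr ?_
    have : ∀ u ∈ weakReach G f 0 v, u = v := by
      intro u hu
      obtain ⟨p, hp, -⟩ := (Finset.mem_filter.mp hu).2
      exact (Walk.eq_of_length_eq_zero (Nat.le_zero.mp hp)).symm
    intro a ha b hb
    rw [this a ha, this b hb]
  | succ n ih =>
    obtain ⟨Z, hZ, hvZ, hsep⟩ := h v
    have hsub : weakReach G f (n + 1) v ⊆ insert v (Z.biUnion fun z => weakReach G f n z) := by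
      intro u hu
      by_cases huv : u = v
      · exact huv ▸ Finset.mem_insert_self _ _
      obtain ⟨p, hp, hpu⟩ := (Finset.mem_filter.mp hu).2
      have hlt : f u < f v :=
        lt_of_le_of_ne (hpu v p.start_mem_support) fun heq => huv (hinj heq)
      obtain ⟨z, hz, hzp⟩ := hsep u hlt p (hp.trans hn)
      refine Finset.mem_insert_of_mem (Finset.mem_biUnion.mpr ⟨z, hz, ?_⟩)
      refine Finset.mem_filter.mpr ⟨Finset.mem_univ _, p.dropUntil z hzp, ?_, fun x hx =>
        hpu x (p.support_dropUntil_subset_support hzp hx)⟩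
      have h1 := congrArg Walk.length (p.take_spec hzp)
      rw [Walk.length_append] at h1
      have h2 : (p.takeUntil z hzp).length ≠ 0 := fun h0 =>
        hvZ (Walk.eq_of_length_eq_zero h0 ▸ hz)
      omega
    calc (weakReach G f (n + 1) v).card ≤ _ := Finset.card_le_card hsub
      _ ≤ (Z.biUnion fun z => weakReach G f n z).card + 1 := Finset.card_insert_le _ _
      _ ≤ Z.card * (K + 1) ^ n + 1 := by
        gcongr
        exact Finset.card_biUnion_le_card_mul _ _ _ fun z _ => ih (by omega) z
      _ ≤ K * (K + 1) ^ n + (K + 1) ^ n := by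
        gcongr
        exact Nat.one_le_pow _ _ (Nat.succ_pos _)
      _ = (K + 1) ^ (n + 1) := by ring

/-- The clusters of vertices from which a given vertex is weakly reachable form a cover. -/
lemma exists_cover_of_weakReach [Fintype V] (G : SimpleGraph V) (f : V → ℕ) (r d : ℕ)
    (hf : ∀ v, (weakReach G f (2 * r) v).card ≤ d) :
    ∃ X : Set (Set V), IsNbhdCover G r (2 * r) X ∧ ∀ v, {Y ∈ X | v ∈ Y}.ncard ≤ d := by
  let Y : V → Set V := fun u => {w | WalkIn G {x | f u ≤ f x} (2 * r) u w}
  refine ⟨Set.range Y, ⟨?_, ?_⟩, ?_⟩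
  · rintro _ ⟨u, rfl⟩
    exact hasRadiusLE_induce_iff.mpr
      ⟨u, WalkIn.refl (le_refl (f u)), fun w hw => WalkIn.within_reach hw⟩
  · intro v
    obtain ⟨u, hu, hmin⟩ := (Finset.univ.filter fun u => u ∈ ball G r v).exists_min_image f
      ⟨v, by simpa using ⟨.nil, by simp⟩⟩
    simp only [Finset.mem_filter, Finset.mem_univ, true_and] at hu hmin
    have key : ∀ w ∈ ball G r v, WalkIn G {x | f u ≤ f x} r v w := by
      rintro w ⟨p, hp⟩
      refine ⟨p, hp, fun x hx => hmin x ⟨p.takeUntil x hx, ?_⟩⟩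
      exact (p.length_takeUntil_le_length hx).trans hp
    refine ⟨Y u, ⟨u, rfl⟩, fun w hw => ?_⟩
    exact ((key u hu).symm.trans (key w hw)).mono subset_rfl (by omega)
  · intro v
    refine le_trans ?_ (hf v)
    have hsub : {C ∈ Set.range Y | v ∈ C} ⊆ Y '' (weakReach G f (2 * r) v : Set V) := by
      rintro _ ⟨⟨u, rfl⟩, hv⟩
      refine ⟨u, ?_, rfl⟩
      rw [Finset.mem_coe]
      exact Finset.mem_filter.mpr ⟨Finset.mem_univ _, WalkIn.symm hv⟩
    calc _ ≤ (Y '' (weakReach G f (2 * r) v : Set V)).ncard :=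
          Set.ncard_le_ncard hsub (Set.toFinite _)
      _ ≤ (weakReach G f (2 * r) v : Set V).ncard := Set.ncard_image_le (Set.toFinite _)
      _ = _ := Set.ncard_coe_finset _

/-- Sparsity of shallow minors yields sparse neighborhood covers. -/
lemma exists_cover_of_sparse_minors [Fintype V] (G : SimpleGraph V) (r c : ℕ)
    (dens : ∀ (N : Type) [Fintype N] (F : SimpleGraph N), IsDepthMinor (2 * (2 * r)) F G →
      adjPairs F Finset.univ ≤ c * Fintype.card N) :
    ∃ X : Set (Set V), IsNbhdCover G r (2 * r) X ∧
      ∀ v, {Y ∈ X | v ∈ Y}.ncard ≤ (sepBound c (2 * r) + 1) ^ (2 * r) := by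
  obtain ⟨f, hinj, -, hf⟩ := exists_rank (2 * r) (sepBound c (2 * r))
    (exists_small_separator G (2 * r) c dens) Finset.univ
  refine exists_cover_of_weakReach G f r _ fun v => card_weakReach_le (l := 2 * r) ?_ ?_ _ le_rfl v
  · simpa [Set.injOn_univ] using hinj
  · simpa using hf

end Orders

section Robust

variable [Fintype V]

/-- The vertices reachable from `v` by a walk of length at most `i` avoiding `B`. -/
noncomputable def reach (G : SimpleGraph V) (B : Finset V) (i : ℕ) (v : V) : Finset V :=
  Finset.univ.filter fun x => WalkIn G {x | x ∉ B} i v x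

lemma mem_reach {G : SimpleGraph V} {B : Finset V} {i : ℕ} {v x : V} :
    x ∈ reach G B i v ↔ WalkIn G {x | x ∉ B} i v x := by
  simp [reach]

/-- Balls grow exponentially in a graph of large minimum degree whose small subsets are sparse,
even after deleting few vertices. -/
lemma card_reach_ge (G : SimpleGraph V) {a c q : ℝ} (hc : 0 < c) (ha : 0 ≤ a)
    (hdeg : ∀ v, 2 * a ≤ degIn G Finset.univ v)
    (hloc : ∀ Y : Finset V, (Y.card : ℝ) ≤ q → (adjPairs G Y : ℝ) ≤ c * Y.card)
    {B : Finset V} (hB : (B.card : ℝ) ≤ a) {v : V} (hv : v ∉ B) (i : ℕ) :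
    q < (reach G B i v).card ∨ (a / c) ^ i ≤ (reach G B i v).card := by
  induction i with
  | zero =>
    right
    rw [pow_zero]
    have : v ∈ reach G B 0 v := mem_reach.mpr (.refl hv)
    exact_mod_cast Finset.card_pos.mpr ⟨v, this⟩
  | succ i ih =>
    rcases lt_or_ge q (reach G B (i + 1) v).card with h | h
    · exact Or.inl h
    right
    have hsub : reach G B i v ⊆ reach G B (i + 1) v := fun x hx =>
      mem_reach.mpr ((mem_reach.mp hx).mono subset_rfl (Nat.le_succ i))
    have hcard : ((reach G B i v).card : ℝ) ≤ (reach G B (i + 1) v).card := by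
      exact_mod_cast Finset.card_le_card hsub
    have ih' := ih.resolve_left (not_lt.mpr (hcard.trans h))
    have hd : ∀ x ∈ reach G B i v, a ≤ degIn G (reach G B (i + 1) v) x := by
      intro x hx
      have h1 : degIn G Finset.univ x ≤ degIn G (reach G B (i + 1) v) x + B.card := by
        refine (Finset.card_le_card ?_).trans (Finset.card_union_le _ B)
        intro y hy
        by_cases hyB : y ∈ B
        · exact Finset.mem_union_right _ hyB
        · refine Finset.mem_union_left _ (Finset.mem_filter.mpr ⟨mem_reach.mpr ?_, ?_⟩)
          · have hxy := (Finset.mem_filter.mp hy).2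
            have hx' := mem_reach.mp hx
            exact hx'.trans (.of_adj hxy hx'.right_mem hyB)
          · exact (Finset.mem_filter.mp hy).2
      have h2 : (degIn G Finset.univ x : ℝ) ≤ degIn G (reach G B (i + 1) v) x + B.card := by
        exact_mod_cast h1
      linarith [hdeg x]
    have h3 : a * (reach G B i v).card ≤ adjPairs G (reach G B (i + 1) v) := by
      rw [adjPairs_eq_sum, Nat.cast_sum]
      calc a * (reach G B i v).card = ∑ _x ∈ reach G B i v, a := by
            rw [Finset.sum_const, nsmul_eq_mul, mul_comm]
        _ ≤ ∑ x ∈ reach G B i v, (degIn G (reach G B (i + 1) v) x : ℝ) :=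
            Finset.sum_le_sum hd
        _ ≤ _ := Finset.sum_le_sum_of_subset_of_nonneg hsub fun _ _ _ => Nat.cast_nonneg _
    have h4 := h3.trans (hloc _ h)
    calc (a / c) ^ (i + 1) = (a / c) ^ i * a / c := by ring
      _ ≤ (reach G B i v).card * a / c := by gcongr
      _ ≤ _ := by
        rw [div_le_iff₀ hc]
        linarith

/-- `u` and `v` stay joined by a walk of length at most `k` whenever at most `b` other vertices
are deleted. -/
def Robust (G : SimpleGraph V) (b k : ℕ) (u v : V) : Prop :=
  ∀ B : Finset V, B.card ≤ b → u ∉ B → v ∉ B → WalkIn G {x | x ∉ B} k u v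

lemma exists_robust_pair (G : SimpleGraph V) (b k : ℕ) (s : Finset V) {q : ℝ}
    (hball : ∀ B : Finset V, B.card ≤ s.card * s.card * b → ∀ v, v ∉ B → q ≤ (reach G B k v).card)
    (hs : Fintype.card V < s.card * q) :
    ∃ u ∈ s, ∃ v ∈ s, u ≠ v ∧ Robust G b (2 * k) u v := by
  by_contra! hcon
  have hbad : ∀ u v, ∃ B : Finset V, B.card ≤ b ∧ u ∉ B ∧ v ∉ B ∧
      (u ∈ s → v ∈ s → u ≠ v → ¬ WalkIn G {x | x ∉ B} (2 * k) u v) := by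
    intro u v
    by_cases h : u ∈ s ∧ v ∈ s ∧ u ≠ v
    · have := hcon u h.1 v h.2.1 h.2.2
      unfold Robust at this
      push Not at this
      obtain ⟨B, h1, h2, h3, h4⟩ := this
      exact ⟨B, h1, h2, h3, fun _ _ _ => h4⟩
    · exact ⟨∅, by simp, by simp, by simp, fun h1 h2 h3 => absurd ⟨h1, h2, h3⟩ h⟩
  choose bad hbadcard hbadl hbadr hbadw using hbad
  let B := ((s ×ˢ s).biUnion fun e => bad e.1 e.2) \ s
  have hB : B.card ≤ s.card * s.card * b := by
    refine (Finset.card_le_card Finset.sdiff_subset).trans ?_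
    rw [← Finset.card_product]
    exact Finset.card_biUnion_le_card_mul _ _ _ fun e _ => hbadcard _ _
  have hsB : ∀ u ∈ s, u ∉ B := fun u hu h => (Finset.mem_sdiff.mp h).2 hu
  have hnd : ¬ (s : Set V).PairwiseDisjoint (reach G B k) := by
    intro hd
    have h1 := Finset.card_biUnion hd
    have h2 : ((s.biUnion (reach G B k)).card : ℝ) ≤ Fintype.card V := by
      exact_mod_cast Finset.card_le_univ _
    rw [h1, Nat.cast_sum] at h2
    have h3 : s.card * q ≤ ∑ u ∈ s, ((reach G B k u).card : ℝ) := by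
      rw [← nsmul_eq_mul]
      exact Finset.card_nsmul_le_sum _ _ _ fun u hu => hball B hB u (hsB u hu)
    linarith
  simp only [Set.PairwiseDisjoint, Set.Pairwise, not_forall, Function.onFun,
    Finset.not_disjoint_iff] at hnd
  obtain ⟨u, hu, v, hv, huv, y, hyu, hyv⟩ := hnd
  obtain ⟨p, hp, hpB⟩ := (mem_reach.mp hyu).trans (mem_reach.mp hyv).symm
  obtain ⟨w, x, hx, hxp, hwx, n, hn, hw⟩ :=
    exists_first_hit (Q := {x | (x ∈ s ∧ x ≠ u) ∨ x ∈ B}) p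
      (by rintro (h | h); exacts [h.2 rfl, hsB u hu h]) (Or.inl ⟨hv, huv.symm⟩)
  have hxs : x ∈ s ∧ x ≠ u := hx.resolve_right (hpB x hxp)
  have hmem : ∀ y ∈ {x | (x ∈ s ∧ x ≠ u) ∨ x ∈ B}ᶜ, y ∉ bad u x := by
    intro y hy hyb
    have hy' := not_or.mp hy
    by_cases hys : y ∈ s
    · have : y = u := by
        by_contra hne
        exact hy'.1 ⟨hys, hne⟩
      exact hbadl u x (this ▸ hyb)
    · refine hy'.2 (Finset.mem_sdiff.mpr ⟨Finset.mem_biUnion.mpr ⟨(u, x), ?_, hyb⟩, hys⟩)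
      exact Finset.mem_product.mpr ⟨hu, hxs.1⟩
  refine hbadw u x hu hxs.1 hxs.2.symm ?_
  have h1 : WalkIn G {y | y ∉ bad u x} n u w := hw.mono hmem le_rfl
  refine (h1.trans (.of_adj hwx h1.right_mem (hbadr u x))).mono subset_rfl ?_
  omega

end Robust

section CommonNeighbors

/-- A graph without large independent sets contains a set of `t` vertices which pairwise have many
common neighbours. -/
lemma exists_many_common_neighbors [Fintype V] [Nonempty V] (R : SimpleGraph V) (T t b d : ℕ)
    (hind : ∀ I : Finset V, (∀ x ∈ I, ∀ y ∈ I, ¬ R.Adj x y) → I.card ≤ T)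
    (h1 : 4 * T * t * d ≤ Fintype.card V) (h2 : 2 * Fintype.card V * b < t * (d * d)) :
    ∃ S : Finset V, S.card = t ∧ ∀ x ∈ S, ∀ y ∈ S, x ≠ y →
      b ≤ (Finset.univ.filter fun w => R.Adj w x ∧ R.Adj w y).card := by
  by_contra! hcon
  let K : SimpleGraph V := SimpleGraph.fromRel fun x y =>
    (Finset.univ.filter fun w => R.Adj w x ∧ R.Adj w y).card < b
  have hK : ∀ x y, K.Adj x y → (Finset.univ.filter fun w => R.Adj w x ∧ R.Adj w y).card < b := by
    rintro x y ⟨-, h | h⟩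
    · exact h
    · simpa only [and_comm] using h
  have hKind : ∀ I : Finset V, (∀ x ∈ I, ∀ y ∈ I, ¬ K.Adj x y) → I.card ≤ t := by
    intro I hI
    by_contra hlt
    obtain ⟨S, hS, hSt⟩ := Finset.exists_subset_card_eq (not_le.mp hlt).le
    obtain ⟨x, hx, y, hy, hxy, hb⟩ := hcon S hSt
    exact hI x (hS hx) y (hS hy) ⟨hxy, Or.inl hb⟩
  let Nb : V → Finset V := fun w => Finset.univ.filter fun x => R.Adj w x
  let High := Finset.univ.filter fun w => ¬ degIn R Finset.univ w + 1 ≤ 2 * t * d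
  have hHigh : Fintype.card V ≤ High.card + T * (2 * t * d) := by
    obtain ⟨I, hI, hIind, hcard⟩ := exists_indep R
      (Finset.univ.filter fun w => degIn R Finset.univ w + 1 ≤ 2 * t * d) (2 * t * d)
      fun v hv => by
        have := degIn_mono R (Finset.filter_subset
          (fun w => degIn R Finset.univ w + 1 ≤ 2 * t * d) Finset.univ) v
        have h2 := (Finset.mem_filter.mp hv).2
        omega
    have h3 := Finset.card_filter_add_card_filter_not (s := Finset.univ)
      fun w => degIn R Finset.univ w + 1 ≤ 2 * t * d
    have h4 := Nat.mul_le_mul (hind I hIind) (le_refl (2 * t * d))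
    rw [Finset.card_univ] at h3
    change _ + High.card = _ at h3
    omega
  have hdense : ∀ w ∈ High, t * d * d ≤ adjPairs K (Nb w) := by
    intro w hw
    have hw' : 2 * t * d ≤ (Nb w).card := by
      have := (Finset.mem_filter.mp hw).2
      unfold degIn at this
      change ¬ (Nb w).card + 1 ≤ _ at this
      omega
    obtain ⟨I, hI, hIind, hcard⟩ := exists_indep K
      ((Nb w).filter fun x => degIn K (Nb w) x + 1 ≤ d) d fun v hv => by
        have := degIn_mono K (Finset.filter_subset
          (fun x => degIn K (Nb w) x + 1 ≤ d) (Nb w)) v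
        have h2 := (Finset.mem_filter.mp hv).2
        omega
    have h3 := Finset.card_filter_add_card_filter_not (s := Nb w)
      fun x => degIn K (Nb w) x + 1 ≤ d
    have h4 := Nat.mul_le_mul (hKind I hIind) (le_refl d)
    have h5 : t * d ≤ ((Nb w).filter fun x => ¬ degIn K (Nb w) x + 1 ≤ d).card := by
      have : 2 * t * d = t * d + t * d := by ring
      omega
    rw [adjPairs_eq_sum]
    calc t * d * d ≤ ((Nb w).filter fun x => ¬ degIn K (Nb w) x + 1 ≤ d).card * d := by gcongr
      _ ≤ ∑ x ∈ (Nb w).filter fun x => ¬ degIn K (Nb w) x + 1 ≤ d, degIn K (Nb w) x := by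
        rw [← smul_eq_mul]
        refine Finset.card_nsmul_le_sum _ _ _ fun x hx => ?_
        have := (Finset.mem_filter.mp hx).2
        omega
      _ ≤ _ := Finset.sum_le_sum_of_subset (Finset.filter_subset _ _)
  have hcount : High.card * (t * d * d) ≤ Fintype.card V * Fintype.card V * b := by
    calc High.card * (t * d * d) ≤ ∑ w ∈ High, adjPairs K (Nb w) := by
          rw [← smul_eq_mul]
          exact Finset.card_nsmul_le_sum _ _ _ hdense
      _ ≤ ∑ w, adjPairs K (Nb w) :=
          Finset.sum_le_sum_of_subset (Finset.subset_univ _)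
      _ ≤ ∑ w, ((Finset.univ.filter fun e : V × V => K.Adj e.1 e.2).filter
            fun e => R.Adj w e.1 ∧ R.Adj w e.2).card := by
          refine Finset.sum_le_sum fun w _ => Finset.card_le_card fun e he => ?_
          simp only [Finset.mem_filter, Finset.mem_product, Finset.mem_univ, true_and, Nb] at he ⊢
          exact ⟨he.2, he.1⟩
      _ = ∑ e ∈ Finset.univ.filter fun e : V × V => K.Adj e.1 e.2,
            (Finset.univ.filter fun w => R.Adj w e.1 ∧ R.Adj w e.2).card :=
          Finset.sum_card_bipartiteAbove_eq_sum_card_bipartiteBelow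
            fun w (e : V × V) => R.Adj w e.1 ∧ R.Adj w e.2
      _ ≤ (Finset.univ.filter fun e : V × V => K.Adj e.1 e.2).card * b := by
          rw [← smul_eq_mul]
          refine Finset.sum_le_card_nsmul _ _ _ fun e he => ?_
          exact (hK _ _ (Finset.mem_filter.mp he).2).le
      _ ≤ _ := by
          gcongr
          refine (Finset.card_filter_le _ _).trans ?_
          simp
  have hpos : 0 < Fintype.card V := Fintype.card_pos
  have h3 : Fintype.card V ≤ 2 * High.card := by
    have : T * (2 * t * d) * 2 = 4 * T * t * d := by ring
    omega
  have h4 : Fintype.card V * (t * (d * d)) ≤ Fintype.card V * (2 * Fintype.card V * b) := by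
    calc Fintype.card V * (t * (d * d)) ≤ 2 * High.card * (t * (d * d)) := by gcongr
      _ = 2 * (High.card * (t * d * d)) := by ring
      _ ≤ 2 * (Fintype.card V * Fintype.card V * b) := by gcongr
      _ = _ := by ring
  have := Nat.le_of_mul_le_mul_left h4 hpos
  omega

end CommonNeighbors

section Cliques

/-- If robustly joined pairs occur in every set of more than `T` vertices, then there is a shallow
clique minor. -/
lemma isDepthMinor_top_of_robust_pairs [Fintype V] [Nonempty V] (G : SimpleGraph V)
    (k T t d : ℕ)
    (hind : ∀ I : Finset V, T < I.card →
      ∃ u ∈ I, ∃ v ∈ I, u ≠ v ∧ Robust G (t + 4 * k * (t * t)) (2 * k) u v)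
    (h1 : 4 * T * t * d ≤ Fintype.card V)
    (h2 : 2 * Fintype.card V * (t + 4 * k * (t * t) + 1) < t * (d * d)) :
    IsDepthMinor (4 * k) (⊤ : SimpleGraph (Fin t)) G := by
  obtain ⟨R, hR, hR'⟩ : ∃ R : SimpleGraph V,
      (∀ u v, R.Adj u v → Robust G (t + 4 * k * (t * t)) (2 * k) u v) ∧
      ∀ u v, u ≠ v → Robust G (t + 4 * k * (t * t)) (2 * k) u v → R.Adj u v := by
    refine ⟨SimpleGraph.fromRel (Robust G (t + 4 * k * (t * t)) (2 * k)), ?_,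
      fun u v huv h => ⟨huv, Or.inl h⟩⟩
    rintro u v ⟨-, h | h⟩
    · exact h
    · exact fun B hB hu hv => (h B hB hv hu).symm
  obtain ⟨S, hS, hcommon⟩ := exists_many_common_neighbors R T t (t + 4 * k * (t * t) + 1) d
    (fun I hI => by
      by_contra hlt
      obtain ⟨u, hu, v, hv, huv, hrob⟩ := hind I (not_le.mp hlt)
      exact hI u hu v hv (hR' u v huv hrob)) h1 h2
  subst hS
  refine isDepthMinor_top_of_robust G S (4 * k) fun u hu v hv huv B hB huB hvB => ?_
  obtain ⟨w, hw, hwB⟩ := Finset.exists_mem_notMem_of_card_lt_card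
    (lt_of_lt_of_le (Nat.lt_succ_of_le hB) (hcommon u hu v hv huv))
  obtain ⟨hwu, hwv⟩ := (Finset.mem_filter.mp hw).2
  exact ((hR w u hwu B hB hwB huB).symm.trans (hR w v hwv B hB hwB hvB)).mono subset_rfl (by omega)

end Cliques

section DenseCore

lemma adjPairs_univ_le [Fintype V] (G : SimpleGraph V) (v : V) :
    adjPairs G Finset.univ ≤
      adjPairs G (Finset.univ.erase v) + 2 * degIn G Finset.univ v := by
  let N := Finset.univ.filter fun w => G.Adj v w
  have hN : N.card = degIn G Finset.univ v := rfl
  have hsub : ((Finset.univ ×ˢ Finset.univ).filter fun p : V × V => G.Adj p.1 p.2) ⊆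
      ((Finset.univ.erase v ×ˢ Finset.univ.erase v).filter fun p : V × V => G.Adj p.1 p.2) ∪
        (N.image (fun w => (v, w)) ∪ N.image fun w => (w, v)) := by
    rintro ⟨x, y⟩ hxy
    simp only [Finset.mem_filter, Finset.mem_union, Finset.mem_product, Finset.mem_erase,
      Finset.mem_image, Finset.mem_univ, true_and, N, Prod.mk.injEq, and_true] at hxy ⊢
    by_cases hx : x = v
    · subst hx
      exact Or.inr (Or.inl ⟨y, hxy, rfl, rfl⟩)
    by_cases hy : y = v
    · subst hy
      exact Or.inr (Or.inr ⟨x, hxy.symm, rfl, rfl⟩)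
    · exact Or.inl ⟨⟨hx, hy⟩, hxy⟩
  have h1 := (Finset.card_le_card hsub).trans (Finset.card_union_le _ _)
  have h2 := Finset.card_union_le (N.image fun w => (v, w)) (N.image fun w => (w, v))
  have h3 : (N.image fun w => (v, w)).card ≤ N.card := Finset.card_image_le
  have h4 : (N.image fun w => (w, v)).card ≤ N.card := Finset.card_image_le
  unfold adjPairs
  omega

lemma exists_common_neighbor_parameters {m T t b : ℕ} (ht : 1 ≤ t)
    (hm : (128 * t * b + 8 * t + 1 : ℝ) ^ 4 ≤ m) (hT : (T : ℝ) ≤ (m : ℝ) ^ (1 / 4 : ℝ)) :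
    ∃ d : ℕ, 4 * T * t * d ≤ m ∧ 2 * m * b < t * (d * d) := by
  set y : ℝ := (m : ℝ) ^ (1 / 4 : ℝ) with hy
  have hy4 : y ^ 4 = m := by
    rw [hy, ← Real.rpow_natCast, ← Real.rpow_mul (Nat.cast_nonneg _)]
    norm_num
  have hy0 : 0 ≤ y := Real.rpow_nonneg (Nat.cast_nonneg _) _
  have ht' : (1 : ℝ) ≤ t := by exact_mod_cast ht
  have hyZ : (128 * t * b + 8 * t + 1 : ℝ) ≤ y :=
    le_of_pow_le_pow_left₀ (by norm_num) hy0 (hm.trans hy4.ge)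
  have hb0 : (0 : ℝ) ≤ t * b := by positivity
  have hy1 : 1 ≤ y := by nlinarith
  have hyt : 8 * t ≤ y := by nlinarith
  have hyb : 128 * t * b < y := by nlinarith
  have hy2 : y ≤ y ^ 2 := by nlinarith
  have hy3 : y ≤ y ^ 3 := by nlinarith [mul_nonneg hy0 hy0]
  refine ⟨⌊y ^ 3 / (4 * t)⌋₊, ?_, ?_⟩
  · have h1 : (⌊y ^ 3 / (4 * t)⌋₊ : ℝ) ≤ y ^ 3 / (4 * t) := Nat.floor_le (by positivity)
    have : (4 * T * t * ⌊y ^ 3 / (4 * t)⌋₊ : ℝ) ≤ m := by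
      calc (4 * T * t * ⌊y ^ 3 / (4 * t)⌋₊ : ℝ) ≤ 4 * y * t * (y ^ 3 / (4 * t)) := by gcongr
        _ = y ^ 4 := by field_simp
        _ = m := hy4
    exact_mod_cast this
  · have h1 : y ^ 3 / (4 * t) < ⌊y ^ 3 / (4 * t)⌋₊ + 1 := Nat.lt_floor_add_one _
    have h2 : 1 ≤ y ^ 3 / (8 * t) := by
      rw [one_le_div (by positivity)]
      linarith
    have h3 : y ^ 3 / (4 * t) = y ^ 3 / (8 * t) + y ^ 3 / (8 * t) := by
      field_simp
      norm_num
    have h4 : y ^ 3 / (8 * t) ≤ ⌊y ^ 3 / (4 * t)⌋₊ := by linarith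
    have : (2 * m * b : ℝ) < t * (⌊y ^ 3 / (4 * t)⌋₊ * ⌊y ^ 3 / (4 * t)⌋₊) := by
      calc (2 * m * b : ℝ) = y ^ 4 * (128 * t * b) / (64 * t) := by
            rw [← hy4]
            field_simp
            ring
        _ < y ^ 4 * y ^ 2 / (64 * t) := by
            gcongr
            exact hyb.trans_le hy2
        _ = t * (y ^ 3 / (8 * t) * (y ^ 3 / (8 * t))) := by
            field_simp
            norm_num
        _ ≤ _ := by gcongr
    exact_mod_cast this

/-- A dense graph all of whose proper vertex subsets are sparse has a shallow clique minor. -/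
lemma isDepthMinor_top_of_dense_of_minimal {δ : ℝ} (hδ : 0 < δ) (hδ' : δ ≤ 1 / 2) {k t : ℕ}
    (hk : 1 ≤ k * (δ / 2 * δ / 2)) (ht : 1 ≤ t) {κ : ℝ} (hκ1 : 1 < κ)
    (hκb : 16 * ((t + 4 * k * (t * t) : ℕ) : ℝ) ≤ κ)
    (hκg : (4 : ℝ) ^ (1 / (δ / 2 * δ / 2)) ≤ κ)
    (hκc : (128 * t * (t + 4 * k * (t * t) + 1 : ℕ) + 8 * t + 1 : ℝ) ^ 4 ≤ κ)
    [Fintype V] (G : SimpleGraph V)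
    (hdense : κ * (Fintype.card V : ℝ) ^ (1 + δ) < adjPairs G Finset.univ)
    (hmin : ∀ Y : Finset V, Y ≠ Finset.univ → (adjPairs G Y : ℝ) ≤ κ * (Y.card : ℝ) ^ (1 + δ)) :
    IsDepthMinor (4 * k) (⊤ : SimpleGraph (Fin t)) G := by
  have hne : Nonempty V := by
    by_contra h
    rw [not_nonempty_iff] at h
    have h1 := adjPairs_le_sq G Finset.univ
    rw [Finset.card_univ, Fintype.card_eq_zero] at h1
    have h2 : adjPairs G Finset.univ = 0 := by omega
    rw [h2, Fintype.card_eq_zero, Nat.cast_zero, Real.zero_rpow (by linarith)] at hdense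
    simp at hdense
  set b := t + 4 * k * (t * t) with hb
  have hMpos : (0 : ℝ) < Fintype.card V := by exact_mod_cast Fintype.card_pos
  have hκ0 : 0 < κ := by linarith
  obtain ⟨M, hM⟩ : ∃ M : ℝ, M = Fintype.card V := ⟨_, rfl⟩
  rw [← hM] at hdense hMpos
  have hM1 : 1 ≤ M := by
    rw [hM]
    exact_mod_cast (Fintype.card_pos : 0 < Fintype.card V)
  have hMδ : M ^ (1 + δ) = M * M ^ δ := Real.rpow_one_add' hMpos.le (by linarith)
  have hMδ1 : 1 ≤ M ^ δ := Real.one_le_rpow hM1 hδ.le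
  have hκM : κ ≤ M := by
    have h1 : (adjPairs G Finset.univ : ℝ) ≤ M * M := by
      rw [hM]
      exact_mod_cast adjPairs_le_sq G Finset.univ
    have h2 : κ * M ≤ κ * M ^ (1 + δ) := by
      rw [hMδ]
      gcongr
      exact le_mul_of_one_le_right hMpos.le hMδ1
    have h3 : κ * M ≤ M * M := by linarith
    exact le_of_mul_le_mul_right h3 hMpos
  have hMgt : 1 < M := hκ1.trans_le hκM
  obtain ⟨γ, hγ⟩ : ∃ γ, γ = δ / 2 := ⟨_, rfl⟩
  rw [← hγ] at hk hκg
  have hγ0 : 0 < γ := by linarith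
  have hq : M ^ (1 - γ) < M := by
    conv_rhs => rw [← Real.rpow_one M]
    exact Real.rpow_lt_rpow_of_exponent_lt hMgt (by linarith)
  have hdeg : ∀ v, 2 * (κ * M ^ δ / 4) ≤ degIn G Finset.univ v := by
    intro v
    have h1 : (adjPairs G Finset.univ : ℝ) ≤
        adjPairs G (Finset.univ.erase v) + 2 * degIn G Finset.univ v := by
      exact_mod_cast adjPairs_univ_le G v
    have h2 := hmin (Finset.univ.erase v) fun h => by
      have := Finset.mem_univ v
      rw [← h] at this
      simp at this
    have h3 : ((Finset.univ.erase v).card : ℝ) = M - 1 := by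
      rw [Finset.card_erase_of_mem (Finset.mem_univ v), Finset.card_univ, hM,
        Nat.cast_sub Fintype.card_pos, Nat.cast_one]
    rw [h3, Real.rpow_one_add' (by linarith) (by linarith)] at h2
    have h4 : κ * ((M - 1) * (M - 1) ^ δ) ≤ κ * ((M - 1) * M ^ δ) := by
      gcongr
      · linarith
    rw [hMδ] at hdense
    nlinarith
  have hloc : ∀ Y : Finset V, (Y.card : ℝ) ≤ M ^ (1 - γ) →
      (adjPairs G Y : ℝ) ≤ κ * (M ^ (1 - γ)) ^ δ * Y.card := by
    intro Y hY
    have h1 := hmin Y fun h => by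
      rw [h, Finset.card_univ, ← hM] at hY
      linarith
    rw [Real.rpow_one_add' (Nat.cast_nonneg _) (by linarith)] at h1
    calc (adjPairs G Y : ℝ) ≤ κ * (Y.card * (Y.card : ℝ) ^ δ) := h1
      _ ≤ κ * (Y.card * (M ^ (1 - γ)) ^ δ) := by gcongr
      _ = _ := by ring
  have hgrow : M ^ (1 - γ) ≤ (κ * M ^ δ / 4 / (κ * (M ^ (1 - γ)) ^ δ)) ^ k := by
    have e1 : M ^ δ = (M ^ (1 - γ)) ^ δ * (M ^ (γ * δ / 2) * M ^ (γ * δ / 2)) := by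
      rw [← Real.rpow_mul hMpos.le, ← Real.rpow_add hMpos, ← Real.rpow_add hMpos]
      congr 1
      ring
    have e2 : κ * M ^ δ / 4 / (κ * (M ^ (1 - γ)) ^ δ) =
        M ^ (γ * δ / 2) * M ^ (γ * δ / 2) / 4 := by
      rw [e1]
      have : (M ^ (1 - γ)) ^ δ ≠ 0 := (Real.rpow_pos_of_pos (Real.rpow_pos_of_pos hMpos _) _).ne'
      field_simp
    have e3 : 4 ≤ M ^ (γ * δ / 2) := by
      calc (4 : ℝ) = ((4 : ℝ) ^ (1 / (γ * δ / 2))) ^ (γ * δ / 2) := by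
            rw [← Real.rpow_mul (by norm_num), one_div_mul_cancel (by positivity), Real.rpow_one]
        _ ≤ M ^ (γ * δ / 2) := by
            gcongr
            exact hκg.trans hκM
    have e4 : M ^ (γ * δ / 2) ≤ M ^ (γ * δ / 2) * M ^ (γ * δ / 2) / 4 := by nlinarith
    rw [e2]
    calc M ^ (1 - γ) ≤ M ^ (1 : ℝ) := Real.rpow_le_rpow_of_exponent_le hM1 (by linarith)
      _ ≤ M ^ (γ * δ / 2 * k) := Real.rpow_le_rpow_of_exponent_le hM1 (by linarith)
      _ = (M ^ (γ * δ / 2)) ^ k := by rw [Real.rpow_mul hMpos.le, Real.rpow_natCast]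
      _ ≤ _ := by gcongr
  have hMγ1 : 1 ≤ M ^ γ := Real.one_le_rpow hM1 hγ0.le
  have hTle : (⌊M ^ γ⌋₊ : ℝ) ≤ M ^ γ := Nat.floor_le (by positivity)
  obtain ⟨d, hd1, hd2⟩ := exists_common_neighbor_parameters (m := Fintype.card V)
    (T := ⌊M ^ γ⌋₊) (b := b + 1) ht (by rw [← hM]; exact hκc.trans hκM)
    (by
      rw [← hM]
      exact hTle.trans (Real.rpow_le_rpow_of_exponent_le hM1 (by linarith)))
  refine isDepthMinor_top_of_robust_pairs G k ⌊M ^ γ⌋₊ t d (fun I hI => ?_) hd1 hd2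
  obtain ⟨s, hsI, hs⟩ := Finset.exists_subset_card_eq (Nat.succ_le_of_lt hI)
  have hscard : (s.card : ℝ) = ⌊M ^ γ⌋₊ + 1 := by
    rw [hs]
    push_cast
    rfl
  suffices h : ∃ u ∈ s, ∃ v ∈ s, u ≠ v ∧ Robust G b (2 * k) u v by
    obtain ⟨u, hu, v, hv, huv, hrob⟩ := h
    exact ⟨u, hsI hu, v, hsI hv, huv, hrob⟩
  refine exists_robust_pair G b k s (q := M ^ (1 - γ)) ?_ ?_
  · intro B hB v hv
    have hB' : (B.card : ℝ) ≤ κ * M ^ δ / 4 := by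
      have h1 : (B.card : ℝ) ≤ s.card * s.card * b := by exact_mod_cast hB
      have h2 : (s.card : ℝ) ≤ 2 * M ^ γ := by linarith
      have h3 : M ^ δ = M ^ γ * M ^ γ := by
        rw [← Real.rpow_add hMpos]
        congr 1
        linarith
      calc (B.card : ℝ) ≤ s.card * s.card * b := h1
        _ ≤ (2 * M ^ γ) * (2 * M ^ γ) * b := by gcongr
        _ = M ^ δ * (16 * (b : ℝ)) / 4 := by
          rw [h3]
          ring
        _ ≤ M ^ δ * κ / 4 := by gcongr
        _ = _ := by ring
    rcases card_reach_ge G (by positivity) (by positivity) hdeg hloc hB' hv k with h | h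
    · exact h.le
    · exact hgrow.trans h
  · have h1 : M ^ γ < s.card := by
      rw [hscard]
      exact Nat.lt_floor_add_one _
    have h2 : M = M ^ γ * M ^ (1 - γ) := by
      rw [← Real.rpow_add hMpos]
      simp
    rw [← hM]
    nth_rewrite 1 [h2]
    have : 0 < M ^ (1 - γ) := Real.rpow_pos_of_pos hMpos _
    gcongr

/-- A graph with `κ |V|^(1+δ)` edges contains a clique minor whose depth depends on `δ` only. -/
lemma exists_density_bound {δ : ℝ} (hδ : 0 < δ) (hδ' : δ ≤ 1 / 2) :
    ∃ D : ℕ, ∀ t : ℕ, ∃ κ : ℝ, 0 < κ ∧ ∀ (V : Type) [Fintype V] (G : SimpleGraph V),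
      ¬ IsDepthMinor D (⊤ : SimpleGraph (Fin t)) G →
        (adjPairs G Finset.univ : ℝ) ≤ κ * (Fintype.card V : ℝ) ^ (1 + δ) := by
  obtain ⟨k, hk⟩ := exists_nat_ge (1 / (δ / 2 * δ / 2))
  rw [div_le_iff₀ (by positivity)] at hk
  refine ⟨4 * k, fun t => ?_⟩
  rcases Nat.eq_zero_or_pos t with rfl | ht
  · refine ⟨1, one_pos, fun V _ G h => (h ?_).elim⟩
    exact ⟨fun _ => ∅, fun i => i.elim0, fun i => i.elim0, fun i => i.elim0⟩
  have p1 : (0 : ℝ) ≤ 16 * ((t + 4 * k * (t * t) : ℕ) : ℝ) := by positivity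
  have p2 : (0 : ℝ) ≤ (4 : ℝ) ^ (1 / (δ / 2 * δ / 2)) := by positivity
  have p3 : (0 : ℝ) ≤ (128 * t * (t + 4 * k * (t * t) + 1 : ℕ) + 8 * t + 1 : ℝ) ^ 4 := by
    positivity
  refine ⟨2 + 16 * ((t + 4 * k * (t * t) : ℕ) : ℝ) + (4 : ℝ) ^ (1 / (δ / 2 * δ / 2)) +
    (128 * t * (t + 4 * k * (t * t) + 1 : ℕ) + 8 * t + 1 : ℝ) ^ 4, by linarith,
    fun V _ G hG => ?_⟩
  generalize hκ : 2 + 16 * ((t + 4 * k * (t * t) : ℕ) : ℝ) + (4 : ℝ) ^ (1 / (δ / 2 * δ / 2)) +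
    (128 * t * (t + 4 * k * (t * t) + 1 : ℕ) + 8 * t + 1 : ℝ) ^ 4 = κ
  by_contra! hlt
  obtain ⟨X, hX, hXmin⟩ := (Finset.univ.filter fun X : Finset V =>
    κ * (X.card : ℝ) ^ (1 + δ) < adjPairs G X).exists_min_image Finset.card
      ⟨Finset.univ, by simpa using hlt⟩
  simp only [Finset.mem_filter, Finset.mem_univ, true_and] at hX hXmin
  refine hG ((isDepthMinor_top_of_dense_of_minimal hδ hδ' (k := k) (t := t) hk ht (κ := κ)
    (by linarith) (by linarith) (by linarith) (by linarith) (G.induce (X : Set V)) ?_ ?_).map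
    Subtype.val Subtype.val_injective fun a b h => h)
  · rw [adjPairs_induce_univ]
    simpa using hX
  · intro Y hY
    rw [adjPairs_induce]
    by_contra! hlt
    have h1 := hXmin _ (by rwa [Finset.card_map])
    rw [Finset.card_map] at h1
    have h2 := Finset.card_lt_univ_of_notMem (s := Y)
      (Classical.not_forall.mp fun h => hY (Finset.eq_univ_iff_forall.mpr h)).choose_spec
    simp at h2
    omega

end DenseCore

section Forward

lemma _root_.IsDepthMinor.card_le [Fintype V] [Fintype W] {r : ℕ} {H : SimpleGraph W}
    {G : SimpleGraph V} (h : IsDepthMinor r H G) : Fintype.card W ≤ Fintype.card V := by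
  obtain ⟨φ, c, h1, h2, -⟩ := isDepthMinor_iff.mp h
  exact Fintype.card_le_of_injective c fun a b hab => h2 a b (c a) (h1 a).1 (hab ▸ (h1 b).1)

lemma sepBound_add_one_le {c l : ℕ} {x : ℝ} (hx : 1 ≤ x) (hc : (c : ℝ) ≤ x) :
    ((sepBound c l + 1 : ℕ) : ℝ) ≤ (4 + 12 * l) * x ^ 3 := by
  have h2 : x ^ 2 ≤ x ^ 3 := pow_le_pow_right₀ hx (by norm_num)
  have h1 : x ≤ x ^ 3 := by simpa using pow_le_pow_right₀ hx (show 1 ≤ 3 by norm_num)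
  have h0 : 1 ≤ x ^ 3 := one_le_pow₀ hx
  have hl : (0 : ℝ) ≤ l := Nat.cast_nonneg l
  unfold sepBound
  push_cast
  calc (2 * c + c * (1 + 4 * l * c * (2 * c + 1)) + 1 : ℝ)
      ≤ 2 * x + x * (1 + 4 * l * x * (2 * x + 1)) + 1 := by gcongr
    _ = 3 * x + 8 * l * x ^ 3 + 4 * l * x ^ 2 + 1 := by ring
    _ ≤ 3 * x ^ 3 + 8 * l * x ^ 3 + 4 * l * x ^ 3 + x ^ 3 := by gcongr
    _ = _ := by ring

/-- Subgraphs of members of a nowhere dense class have sparse neighborhood covers. -/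
lemma exists_sparse_covers_of_nowhereDense {C : Set FGraph} (hC : NowhereDense C) (r : ℕ) {ε : ℝ}
    (hε : 0 < ε) : ∃ d : ℝ, ∀ H : FGraph, (∃ G ∈ C, IsSubgraphOf H G) →
      ∃ X : Set (Set H.V), IsNbhdCover H.G r (2 * r) X ∧
        ∀ v : H.V, (({Y ∈ X | v ∈ Y}).ncard : ℝ) ≤ d * (Fintype.card H.V : ℝ) ^ ε := by
  have hr0 : (0 : ℝ) ≤ r := Nat.cast_nonneg r
  obtain ⟨δ, hδ⟩ : ∃ δ, δ = min (1 / 2) (ε / (6 * r + 1)) := ⟨_, rfl⟩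
  have hδ0 : 0 < δ := by
    rw [hδ]
    positivity
  have hδε : 6 * r * δ ≤ ε := by
    have h1 : δ ≤ ε / (6 * r + 1) := hδ ▸ min_le_right _ _
    rw [le_div_iff₀ (by positivity)] at h1
    nlinarith
  obtain ⟨D, hD⟩ := exists_density_bound hδ0 (hδ ▸ min_le_left _ _)
  obtain ⟨t, ht⟩ := hC ((2 * (2 * (2 * r)) + 1) * D + 2 * (2 * r))
  obtain ⟨κ, hκ, hκD⟩ := hD t
  refine ⟨(4 + 12 * (2 * r : ℕ)) ^ (2 * r) * (κ + 1) ^ (6 * r), fun H hH => ?_⟩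
  obtain ⟨G, hG, f, hf, hadj⟩ := hH
  set n := Fintype.card H.V with hn
  obtain ⟨X, hX, hXcard⟩ := exists_cover_of_sparse_minors H.G r ⌈κ * (n : ℝ) ^ δ⌉₊
    fun N _ F hF => by
      have h1 := hκD N F fun hK => ht G hG ((hK.trans hF).map f hf hadj)
      have h2 : (Fintype.card N : ℝ) ≤ n := by exact_mod_cast hF.card_le
      rw [Real.rpow_one_add' (Nat.cast_nonneg _) (by linarith)] at h1
      have h3 : (adjPairs F Finset.univ : ℝ) ≤ ⌈κ * (n : ℝ) ^ δ⌉₊ * Fintype.card N := by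
        calc (adjPairs F Finset.univ : ℝ)
            ≤ κ * (Fintype.card N * (Fintype.card N : ℝ) ^ δ) := h1
          _ ≤ κ * (Fintype.card N * (n : ℝ) ^ δ) := by gcongr
          _ = κ * (n : ℝ) ^ δ * Fintype.card N := by ring
          _ ≤ _ := by
            gcongr
            exact Nat.le_ceil _
      exact_mod_cast h3
  refine ⟨X, hX, fun v => ?_⟩
  have hn1 : (1 : ℝ) ≤ n := by
    exact_mod_cast (Fintype.card_pos_iff.mpr ⟨v⟩ : 0 < Fintype.card H.V)
  have hnδ : 1 ≤ (n : ℝ) ^ δ := Real.one_le_rpow hn1 hδ0.le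
  have hc : (⌈κ * (n : ℝ) ^ δ⌉₊ : ℝ) ≤ (κ + 1) * (n : ℝ) ^ δ := by
    have := Nat.ceil_lt_add_one (show 0 ≤ κ * (n : ℝ) ^ δ by positivity)
    linarith
  have hx : 1 ≤ (κ + 1) * (n : ℝ) ^ δ := by nlinarith
  calc (({Y ∈ X | v ∈ Y}).ncard : ℝ)
      ≤ ((sepBound ⌈κ * (n : ℝ) ^ δ⌉₊ (2 * r) + 1 : ℕ) : ℝ) ^ (2 * r) := by
        exact_mod_cast hXcard v
    _ ≤ ((4 + 12 * (2 * r : ℕ)) * ((κ + 1) * (n : ℝ) ^ δ) ^ 3) ^ (2 * r) := by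
        gcongr
        exact sepBound_add_one_le hx hc
    _ = (4 + 12 * (2 * r : ℕ)) ^ (2 * r) * (κ + 1) ^ (6 * r) * (n : ℝ) ^ (6 * r * δ) := by
        have h1 : (n : ℝ) ^ (6 * r * δ) = ((n : ℝ) ^ δ) ^ (6 * r) := by
          rw [← Real.rpow_natCast, ← Real.rpow_mul (Nat.cast_nonneg _)]
          congr 1
          push_cast
          ring
        rw [h1, mul_pow, mul_pow, mul_pow, ← pow_mul, ← pow_mul, show 3 * (2 * r) = 6 * r by ring,
          mul_assoc]
    _ ≤ _ := by
        gcongr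

end Forward

section HighGirth

/-- Every cycle of `F` has length greater than `L + 1`. -/
def HighGirth (F : SimpleGraph V) (L : ℕ) : Prop :=
  ∀ x y, F.Adj x y → ∀ p : F.Walk x y, s(x, y) ∉ p.edges → L < p.length

/-- A walk in `F` with one additional edge either can be replaced by a walk in `F`, or splits
along the additional edge. -/
lemma walk_sup_edge {F : SimpleGraph V} {v w x y : V} (p : (F ⊔ edge v w).Walk x y) :
    (∃ q : F.Walk x y, q.length ≤ p.length ∧ q.edges ⊆ p.edges) ∨
      s(v, w) ∈ p.edges ∧ ∃ a b, ((a = v ∧ b = w) ∨ (a = w ∧ b = v)) ∧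
        ∃ (q : F.Walk x a) (q' : F.Walk b y), q.length + q'.length + 1 ≤ p.length ∧
          q'.edges ⊆ p.edges := by
  induction p with
  | nil => exact Or.inl ⟨.nil, by simp, by simp⟩
  | @cons x x' y h p ih =>
    by_cases hF : F.Adj x x'
    · rcases ih with ⟨q, hq, hqe⟩ | ⟨hvw, a, b, hab, q, q', hq, hqe⟩
      · refine Or.inl ⟨.cons hF q, by simpa using hq, ?_⟩
        rw [Walk.edges_cons, Walk.edges_cons]
        exact List.cons_subset_cons _ hqe
      · refine Or.inr ⟨by simp [hvw], a, b, hab, .cons hF q, q', ?_, ?_⟩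
        · rw [Walk.length_cons, Walk.length_cons]
          omega
        · rw [Walk.edges_cons]
          exact List.subset_cons_of_subset _ hqe
    · have hx : (x = v ∧ x' = w) ∨ (x = w ∧ x' = v) := by
        rw [sup_adj, edge_adj] at h
        rcases h with h | h
        · exact absurd h hF
        · exact h.1
      have he : s(v, w) ∈ (Walk.cons h p).edges := by
        rcases hx with ⟨rfl, rfl⟩ | ⟨rfl, rfl⟩ <;> simp [Sym2.eq_swap]
      rcases ih with ⟨q, hq, hqe⟩ | ⟨hvw, a, b, hab, q, q', hq, hqe⟩
      · refine Or.inr ⟨he, x, x', hx, .nil, q, by simpa using hq, ?_⟩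
        rw [Walk.edges_cons]
        exact List.subset_cons_of_subset _ hqe
      · by_cases hbx : b = x
        · subst hbx
          refine Or.inl ⟨q', by rw [Walk.length_cons]; omega, ?_⟩
          rw [Walk.edges_cons]
          exact List.subset_cons_of_subset _ hqe
        · have hbx' : b = x' := by
            rcases hx with ⟨rfl, rfl⟩ | ⟨rfl, rfl⟩ <;> rcases hab with ⟨rfl, rfl⟩ | ⟨rfl, rfl⟩ <;>
              first | rfl | exact absurd rfl hbx
          subst hbx'
          refine Or.inr ⟨he, x, b, hx, .nil, q', by rw [Walk.length_cons, Walk.length_nil]; omega, ?_⟩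
          rw [Walk.edges_cons]
          exact List.subset_cons_of_subset _ hqe

lemma HighGirth.sup_edge {F : SimpleGraph V} {L : ℕ} (hF : HighGirth F L) {v w : V}
    (hvw : ∀ p : F.Walk v w, L < p.length) : HighGirth (F ⊔ edge v w) L := by
  intro x y hxy p hp
  have hwv : ∀ p : F.Walk w v, L < p.length := fun p => by
    simpa using hvw p.reverse
  rw [sup_adj, edge_adj] at hxy
  rcases walk_sup_edge p with ⟨q, hq, hqe⟩ | ⟨he, a, b, hab, q, q', hq, -⟩
  · rcases hxy with hxy | ⟨⟨rfl, rfl⟩ | ⟨rfl, rfl⟩, -⟩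
    · exact (hF x y hxy q fun h => hp (hqe h)).trans_le hq
    · exact (hvw q).trans_le hq
    · exact (hwv q).trans_le hq
  · rcases hxy with hxy | ⟨⟨rfl, rfl⟩ | ⟨rfl, rfl⟩, -⟩
    · have hlen : ((q.reverse.append hxy.toWalk).append q'.reverse).length =
          q.length + q'.length + 1 := by
        simp [Walk.length_append]
        omega
      rcases hab with ⟨rfl, rfl⟩ | ⟨rfl, rfl⟩
      · have := hvw ((q.reverse.append hxy.toWalk).append q'.reverse)
        omega
      · have := hwv ((q.reverse.append hxy.toWalk).append q'.reverse)
        omega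
    · exact absurd he hp
    · exact absurd he (Sym2.eq_swap ▸ hp)

lemma card_reach_empty_le [Fintype V] {F : SimpleGraph V} {D : ℕ}
    (hD : ∀ v, degIn F Finset.univ v ≤ D) (i : ℕ) (v : V) :
    (reach F ∅ i v).card ≤ (D + 1) ^ i := by
  induction i generalizing v with
  | zero =>
    have : reach F ∅ 0 v ⊆ {v} := by
      intro x hx
      obtain ⟨p, hp, -⟩ := mem_reach.mp hx
      exact Finset.mem_singleton.mpr (Walk.eq_of_length_eq_zero (Nat.le_zero.mp hp)).symm
    simpa using Finset.card_le_card this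
  | succ i ih =>
    have hsub : reach F ∅ (i + 1) v ⊆
        (insert v (Finset.univ.filter fun w => F.Adj v w)).biUnion (reach F ∅ i) := by
      intro x hx
      obtain ⟨p, hp, -⟩ := mem_reach.mp hx
      cases p with
      | nil =>
        exact Finset.mem_biUnion.mpr ⟨v, Finset.mem_insert_self _ _, mem_reach.mpr (.refl (by simp))⟩
      | @cons _ w _ h q =>
        refine Finset.mem_biUnion.mpr ⟨w, by simp [h], mem_reach.mpr ⟨q, ?_, by simp⟩⟩
        simpa using hp
    refine (Finset.card_le_card hsub).trans
      ((Finset.card_biUnion_le_card_mul _ _ _ fun w _ => ih w).trans ?_)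
    rw [pow_succ, mul_comm]
    gcongr
    exact (Finset.card_insert_le _ _).trans (Nat.succ_le_succ (hD v))

lemma degIn_sup_edge_le [Fintype V] {F : SimpleGraph V} {v w : V} (x : V) :
    degIn (F ⊔ edge v w) Finset.univ x ≤
      degIn F Finset.univ x + if x = v ∨ x = w then 1 else 0 := by
  generalize hK : F ⊔ edge v w = K
  have key : ∀ z, (∀ y, K.Adj x y → F.Adj x y ∨ y = z) →
      degIn K Finset.univ x ≤ degIn F Finset.univ x + 1 := by
    intro z hz
    refine (Finset.card_le_card (t := insert z (Finset.univ.filter fun y => F.Adj x y)) ?_).trans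
      (Finset.card_insert_le _ _)
    intro y hy
    have := hz y (Finset.mem_filter.mp hy).2
    simp only [Finset.mem_insert, Finset.mem_filter, Finset.mem_univ, true_and]
    exact this.symm
  split_ifs with h
  · rcases h with rfl | rfl
    · refine key w fun y hy => ?_
      rw [← hK, sup_adj, edge_adj] at hy
      grind
    · refine key v fun y hy => ?_
      rw [← hK, sup_adj, edge_adj] at hy
      grind
  · refine Finset.card_le_card fun y hy => ?_
    have hy := (Finset.mem_filter.mp hy).2
    rw [← hK, sup_adj, edge_adj] at hy
    refine Finset.mem_filter.mpr ⟨Finset.mem_univ _, ?_⟩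
    grind

/-- There are graphs of large girth and large average degree. -/
lemma exists_highGirth [Fintype V] {L D : ℕ} (hL : 1 ≤ L)
    (hN : 2 * (D + 1) ^ L ≤ Fintype.card V) :
    ∃ F : SimpleGraph V, HighGirth F L ∧ Fintype.card V * D ≤ 2 * adjPairs F Finset.univ := by
  obtain ⟨F, hF⟩ := (Set.toFinite {F : SimpleGraph V | HighGirth F L ∧
    ∀ v, degIn F Finset.univ v ≤ D}).exists_maximal
      ⟨⊥, fun x y h => h.elim, fun v => by simp [degIn]⟩
  obtain ⟨hFL, hFD⟩ := hF.prop
  refine ⟨F, hFL, ?_⟩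
  let Low := Finset.univ.filter fun v => degIn F Finset.univ v < D
  have hLow : Low.card ≤ (D + 1) ^ L := by
    rcases Low.eq_empty_or_nonempty with h | ⟨v, hv⟩
    · simp [h]
    refine (Finset.card_le_card fun w hw => ?_).trans (card_reach_empty_le hFD L v)
    have hv := (Finset.mem_filter.mp hv).2
    have hw := (Finset.mem_filter.mp hw).2
    by_contra hcon
    have hvw : ∀ p : F.Walk v w, L < p.length := by
      intro p
      by_contra hp
      exact hcon (mem_reach.mpr ⟨p, not_lt.mp hp, by simp⟩)
    have hne : v ≠ w := by
      rintro rfl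
      exact hcon (mem_reach.mpr (.refl (by simp)))
    have hmem : F ⊔ edge v w ∈ {F : SimpleGraph V | HighGirth F L ∧
        ∀ v, degIn F Finset.univ v ≤ D} := by
      refine ⟨hFL.sup_edge hvw, fun x => (degIn_sup_edge_le x).trans ?_⟩
      split_ifs with h
      · rcases h with rfl | rfl <;> omega
      · exact hFD x
    have hadj : F.Adj v w := hF.le_of_ge hmem le_sup_left (by simp [edge_adj, hne])
    have := hvw hadj.toWalk
    simp at this
    omega
  have h1 := Finset.card_filter_add_card_filter_not (s := Finset.univ)
    fun v => degIn F Finset.univ v < D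
  rw [Finset.card_univ] at h1
  change Low.card + _ = _ at h1
  have h2 : (Finset.univ.filter fun v => ¬ degIn F Finset.univ v < D).card * D ≤
      adjPairs F Finset.univ := by
    rw [adjPairs_eq_sum, ← smul_eq_mul]
    exact (Finset.card_nsmul_le_sum _ _ _ fun v hv => not_lt.mp (Finset.mem_filter.mp hv).2).trans
      (Finset.sum_le_sum_of_subset (Finset.filter_subset _ _))
  calc Fintype.card V * D
      ≤ 2 * (Finset.univ.filter fun v => ¬ degIn F Finset.univ v < D).card * D := by
        gcongr
        omega
    _ ≤ _ := by
        rw [mul_assoc]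
        gcongr

end HighGirth

section Backward

/-- A vertex set of small radius in a graph of high girth spans few edges. -/
lemma HighGirth.adjPairs_le {F : SimpleGraph V} {L ρ : ℕ} (hF : HighGirth F L)
    (hL : 2 * ρ + 1 ≤ L) (T : Finset V) (u : V) (hT : ∀ a ∈ T, ∃ p : F.Walk u a, p.length ≤ ρ) :
    adjPairs F T ≤ 2 * T.card := by
  have hdist : ∀ a ∈ T, ∃ p : F.Walk u a, p.length = F.dist u a ∧ F.dist u a ≤ ρ := by
    intro a ha
    obtain ⟨p, hp⟩ := hT a ha
    obtain ⟨q, hq⟩ := p.reachable.exists_walk_length_eq_dist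
    exact ⟨q, hq, (dist_le p).trans hp⟩
  have hnot : ∀ x y (p : F.Walk u x), p.length = F.dist u x → F.Adj x y →
      F.dist u x ≤ F.dist u y → y ∉ p.support := by
    intro x y p hp hxy hd hy
    have h1 := p.length_takeUntil_lt_length hy hxy.ne'
    have h2 := dist_le (p.takeUntil y hy)
    omega
  have huniq : ∀ x₁ ∈ T, ∀ x₂ ∈ T, ∀ y, F.Adj x₁ y → F.Adj x₂ y → F.dist u x₁ ≤ F.dist u y →
      F.dist u x₂ ≤ F.dist u y → x₁ = x₂ := by
    intro x₁ h₁ x₂ h₂ y hy₁ hy₂ hd₁ hd₂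
    by_contra hne
    obtain ⟨p₁, hp₁, hρ₁⟩ := hdist x₁ h₁
    obtain ⟨p₂, hp₂, hρ₂⟩ := hdist x₂ h₂
    have hlt := hF x₁ y hy₁ ((p₁.reverse.append p₂).append hy₂.toWalk) ?_
    · simp only [Walk.length_append, Walk.length_reverse, Walk.length_cons, Walk.length_nil] at hlt
      omega
    · intro he
      simp only [Walk.edges_append, Walk.edges_reverse, List.mem_append, List.mem_reverse,
        Walk.edges_cons, Walk.edges_nil, List.mem_singleton] at he
      rcases he with (he | he) | he
      · exact hnot x₁ y p₁ hp₁ hy₁ hd₁ (p₁.snd_mem_support_of_mem_edges he)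
      · exact hnot x₂ y p₂ hp₂ hy₂ hd₂ (p₂.snd_mem_support_of_mem_edges he)
      · rw [Sym2.congr_left] at he
        exact hne he
  let P := ((T ×ˢ T).filter fun p => F.Adj p.1 p.2)
  have h1 : (P.filter fun p => F.dist u p.1 ≤ F.dist u p.2).card ≤ T.card := by
    refine Finset.card_le_card_of_injOn Prod.snd (fun p hp => ?_) fun p hp q hq hpq => ?_
    · simp only [P, Finset.coe_filter, Finset.mem_filter, Finset.mem_product] at hp
      exact hp.1.1.2
    · simp only [P, Finset.coe_filter, Finset.mem_filter, Finset.mem_product] at hp hq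
      refine Prod.ext (huniq _ hp.1.1.1 _ hq.1.1.1 p.2 hp.1.2 ?_ hp.2 ?_) hpq
      · rw [hpq]
        exact hq.1.2
      · rw [hpq]
        exact hq.2
  have h2 : (P.filter fun p => ¬ F.dist u p.1 ≤ F.dist u p.2).card ≤ T.card := by
    refine Finset.card_le_card_of_injOn Prod.fst (fun p hp => ?_) fun p hp q hq hpq => ?_
    · simp only [P, Finset.coe_filter, Finset.mem_filter, Finset.mem_product] at hp
      exact hp.1.1.1
    · simp only [P, Finset.coe_filter, Finset.mem_filter, Finset.mem_product] at hp hq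
      refine Prod.ext hpq (huniq _ hp.1.1.2 _ hq.1.1.2 p.1 hp.1.2.symm ?_ (not_le.mp hp.2).le ?_)
      · rw [hpq]
        exact hq.1.2.symm
      · rw [hpq]
        exact (not_le.mp hq.2).le
  have h3 := Finset.card_filter_add_card_filter_not (s := P)
    fun p => F.dist u p.1 ≤ F.dist u p.2
  change P.card ≤ _
  omega

/-- `H` contracts onto `F`, with `ctr` selecting a vertex in each fibre such that edges of `F` are
realised by walks of length at most `r` between selected vertices. -/
structure IsModel (H : SimpleGraph V) (F : SimpleGraph W) (r : ℕ) (br : V → W) (ctr : W → V) :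
    Prop where
  br_ctr : ∀ a, br (ctr a) = a
  adj : ∀ x y, H.Adj x y → br x = br y ∨ F.Adj (br x) (br y)
  walk : ∀ a b, F.Adj a b → ∃ p : H.Walk (ctr a) (ctr b), p.length ≤ r

lemma IsModel.exists_walk {H : SimpleGraph V} {F : SimpleGraph W} {r : ℕ} {br : V → W}
    {ctr : W → V} (h : IsModel H F r br ctr) {x y : V} (p : H.Walk x y) :
    ∃ q : F.Walk (br x) (br y), q.length ≤ p.length := by
  induction p with
  | nil => exact ⟨.nil, by simp⟩
  | @cons x z y hxz p ih =>
    obtain ⟨q, hq⟩ := ih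
    rcases h.adj x z hxz with he | ha
    · exact ⟨q.copy he.symm rfl, by rw [Walk.length_copy, Walk.length_cons]; omega⟩
    · exact ⟨.cons ha q, by simpa using hq⟩

/-- Neighborhood covers of a model of a graph of high girth bound its number of edges. -/
lemma IsModel.adjPairs_le [Fintype V] [Fintype W] {H : SimpleGraph V} {F : SimpleGraph W}
    {r ρ L : ℕ} {br : V → W} {ctr : W → V} (h : IsModel H F r br ctr) (hF : HighGirth F L)
    (hL : 2 * ρ + 1 ≤ L) {X : Set (Set V)} (hX : IsNbhdCover H r ρ X) {Δ : ℝ}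
    (hΔ : ∀ v, (({Y ∈ X | v ∈ Y}).ncard : ℝ) ≤ Δ) :
    (adjPairs F Finset.univ : ℝ) ≤ 2 * (Fintype.card W * Δ) := by
  let X' : Finset (Set V) := (Set.toFinite X).toFinset
  have hX' : ∀ Y, Y ∈ X' ↔ Y ∈ X := fun Y => Set.Finite.mem_toFinset _
  let T : Set V → Finset W := fun Y => Finset.univ.filter fun a => ctr a ∈ Y
  have hT : ∀ Y ∈ X', adjPairs F (T Y) ≤ 2 * (T Y).card := by
    intro Y hY
    obtain ⟨u, -, hu⟩ := hasRadiusLE_induce_iff.mp (hX.1 Y ((hX' Y).mp hY))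
    refine hF.adjPairs_le hL (T Y) (br u) fun a ha => ?_
    obtain ⟨p, hp, -⟩ := hu (ctr a) (Finset.mem_filter.mp ha).2
    obtain ⟨q, hq⟩ := h.exists_walk p
    exact ⟨q.copy rfl (h.br_ctr a), by rw [Walk.length_copy]; exact hq.trans hp⟩
  have hcover : adjPairs F Finset.univ ≤ ∑ Y ∈ X', adjPairs F (T Y) := by
    refine (Finset.card_le_card ?_).trans Finset.card_biUnion_le
    rintro ⟨a, b⟩ hab
    have hab := (Finset.mem_filter.mp hab).2
    obtain ⟨Y, hY, hsub⟩ := hX.2 (ctr a)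
    refine Finset.mem_biUnion.mpr ⟨Y, (hX' Y).mpr hY, Finset.mem_filter.mpr ⟨?_, hab⟩⟩
    refine Finset.mem_product.mpr ⟨?_, ?_⟩
    · exact Finset.mem_filter.mpr ⟨Finset.mem_univ _, hsub ⟨.nil, by simp⟩⟩
    · exact Finset.mem_filter.mpr ⟨Finset.mem_univ _, hsub (h.walk a b hab)⟩
  have hcount : ∑ Y ∈ X', (T Y).card = ∑ a, {Y ∈ X | ctr a ∈ Y}.ncard := by
    have h1 : ∀ a, {Y ∈ X | ctr a ∈ Y}.ncard = (X'.filter fun Y => ctr a ∈ Y).card := by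
      intro a
      rw [← Set.ncard_coe_finset]
      congr 1
      ext Y
      simp [hX']
    simp only [h1]
    exact (Finset.sum_card_bipartiteAbove_eq_sum_card_bipartiteBelow
      fun a (Y : Set V) => ctr a ∈ Y).symm
  have h2 : adjPairs F Finset.univ ≤ 2 * ∑ a, {Y ∈ X | ctr a ∈ Y}.ncard := by
    rw [← hcount, Finset.mul_sum]
    exact hcover.trans (Finset.sum_le_sum hT)
  calc (adjPairs F Finset.univ : ℝ) ≤ 2 * ∑ a, ({Y ∈ X | ctr a ∈ Y}.ncard : ℝ) := by
        exact_mod_cast h2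
    _ ≤ 2 * ∑ _a : W, Δ := by
        gcongr with a
        exact hΔ _
    _ = _ := by
        rw [Finset.sum_const, Finset.card_univ, nsmul_eq_mul]

lemma WalkIn.exists_finset {G : SimpleGraph V} {A : Set V} {n : ℕ} {u v : V}
    (h : WalkIn G A n u v) : ∃ B : Finset V, (B : Set V) ⊆ A ∧ B.card ≤ n + 1 ∧
      WalkIn G (B : Set V) n u v := by
  obtain ⟨p, hp, hpA⟩ := h
  refine ⟨p.support.toFinset, fun x hx => hpA x (by simpa using hx), ?_, p, hp, by simp⟩
  refine (List.toFinset_card_le _).trans ?_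
  rw [Walk.length_support]
  omega

lemma WalkIn.change_graph {G K : SimpleGraph V} {A : Set V} {n : ℕ} {u v : V}
    (h : WalkIn G A n u v) (hadj : ∀ x ∈ A, ∀ y ∈ A, G.Adj x y → K.Adj x y) :
    WalkIn K A n u v := by
  obtain ⟨p, hp, hpA⟩ := h
  have he : ∀ e ∈ p.edges, e ∈ K.edgeSet := by
    intro e he
    induction e with
    | _ x y =>
      exact hadj x (hpA x (p.fst_mem_support_of_mem_edges he)) y
        (hpA y (p.snd_mem_support_of_mem_edges he)) (p.adj_of_mem_edges he)
  exact ⟨p.transfer K he, by simpa using hp, by simpa using hpA⟩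

lemma WalkIn.exists_walk_induce {G : SimpleGraph V} {A : Set V} {n : ℕ} {u v : A}
    (h : WalkIn G A n u v) : ∃ p : (G.induce A).Walk u v, p.length ≤ n := by
  obtain ⟨p, hp, hpA⟩ := h
  refine ⟨p.induce A hpA, ?_⟩
  rw [← Walk.length_map (Embedding.induce A).toHom, Walk.map_induce]
  exact hp

/-- A shallow minor is modelled by a small subgraph. -/
lemma _root_.IsDepthMinor.exists_model [Fintype W] {r : ℕ} {F : SimpleGraph W} {G : FGraph}
    (h : IsDepthMinor r F G.G) : ∃ H : FGraph, IsSubgraphOf H G ∧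
      Fintype.card H.V ≤ (2 * r + 3) * (Fintype.card W * Fintype.card W) ∧
      ∃ br ctr, IsModel H.G F (2 * r + 1) br ctr := by
  obtain ⟨φ, c, h1, h2, h3⟩ := isDepthMinor_iff.mp h
  have hpath : ∀ e : W × W, ∃ B B' : Finset G.V, (B : Set G.V) ⊆ φ e.1 ∧ (B' : Set G.V) ⊆ φ e.2 ∧
      B.card ≤ r + 1 ∧ B'.card ≤ r + 1 ∧ (F.Adj e.1 e.2 → ∃ u v, G.G.Adj u v ∧
        WalkIn G.G (B : Set G.V) r (c e.1) u ∧ WalkIn G.G (B' : Set G.V) r (c e.2) v) := by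
    rintro ⟨a, b⟩
    by_cases hab : F.Adj a b
    · obtain ⟨u, hu, v, hv, huv⟩ := h3 a b hab
      obtain ⟨B, hB, hBc, hw⟩ := ((h1 a).2 u hu).exists_finset
      obtain ⟨B', hB', hBc', hw'⟩ := ((h1 b).2 v hv).exists_finset
      exact ⟨B, B', hB, hB', hBc, hBc', fun _ => ⟨u, v, huv, hw, hw'⟩⟩
    · exact ⟨∅, ∅, by simp, by simp, by simp, by simp, fun h => absurd h hab⟩
  choose B B' hB hB' hBc hBc' hwalk using hpath
  let S : Finset G.V := Finset.univ.image c ∪ Finset.univ.biUnion fun e => B e ∪ B' e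
  have hcS : ∀ a, c a ∈ S := fun a =>
    Finset.mem_union_left _ (Finset.mem_image_of_mem _ (Finset.mem_univ a))
  have hBS : ∀ e, ∀ x ∈ B e ∪ B' e, x ∈ S := fun e x hx =>
    Finset.mem_union_right _ (Finset.mem_biUnion.mpr ⟨e, Finset.mem_univ _, hx⟩)
  have hbr : ∀ x : ↥(S : Set G.V), ∃ a, x.1 ∈ φ a := by
    rintro ⟨x, hx⟩
    rcases Finset.mem_union.mp (Finset.mem_coe.mp hx) with hx | hx
    · obtain ⟨a, -, rfl⟩ := Finset.mem_image.mp hx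
      exact ⟨a, (h1 a).1⟩
    · obtain ⟨e, -, hx⟩ := Finset.mem_biUnion.mp hx
      rcases Finset.mem_union.mp hx with hx | hx
      · exact ⟨e.1, hB e hx⟩
      · exact ⟨e.2, hB' e hx⟩
  choose br hbr using hbr
  let K : SimpleGraph G.V :=
    { Adj := fun x y => G.G.Adj x y ∧ ∃ a b, x ∈ φ a ∧ y ∈ φ b ∧ (a = b ∨ F.Adj a b)
      symm := ⟨fun x y ⟨hxy, a, b, ha, hb, hab⟩ =>
        ⟨hxy.symm, b, a, hb, ha, hab.imp Eq.symm fun h => h.symm⟩⟩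
      loopless := ⟨fun x hx => hx.1.ne rfl⟩ }
  refine ⟨⟨↥(S : Set G.V), K.induce (S : Set G.V)⟩,
    ⟨Subtype.val, Subtype.val_injective, fun a b hab => hab.1⟩, ?_, br,
    fun a => ⟨c a, Finset.mem_coe.mpr (hcS a)⟩, ?_, ?_, ?_⟩
  · have e1 : (Finset.univ.image c).card ≤ Fintype.card W := Finset.card_image_le
    have e2 : (Finset.univ.biUnion fun e => B e ∪ B' e).card ≤
        Fintype.card W * Fintype.card W * (2 * r + 2) := by
      refine (Finset.card_biUnion_le_card_mul _ _ (2 * r + 2) fun e _ => ?_).trans (by simp)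
      have := Finset.card_union_le (B e) (B' e)
      have := hBc e
      have := hBc' e
      omega
    have e3 := Finset.card_union_le (Finset.univ.image c) (Finset.univ.biUnion fun e => B e ∪ B' e)
    have e4 : Fintype.card W ≤ Fintype.card W * Fintype.card W := Nat.le_mul_self _
    have e5 : Fintype.card ↥(S : Set G.V) = S.card := by simp
    change Fintype.card ↥(S : Set G.V) ≤ _
    rw [e5]
    change S.card ≤ _ at e3
    have e6 : (2 * r + 3) * (Fintype.card W * Fintype.card W) =
      Fintype.card W * Fintype.card W * (2 * r + 2) + Fintype.card W * Fintype.card W := by ring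
    omega
  · intro a
    exact h2 _ _ _ (hbr ⟨c a, _⟩) (h1 a).1
  · rintro x y ⟨-, a, b, ha, hb, hab⟩
    rw [h2 _ _ _ (hbr x) ha, h2 _ _ _ (hbr y) hb]
    exact hab
  · intro a b hab
    obtain ⟨u, v, huv, hu, hv⟩ := hwalk (a, b) hab
    have hu' : WalkIn K (S : Set G.V) r (c a) u :=
      (hu.change_graph (K := K) fun x hx y hy hxy =>
        ⟨hxy, a, a, hB (a, b) hx, hB (a, b) hy, Or.inl rfl⟩).mono
          (fun x hx => hBS (a, b) x (Finset.mem_union_left _ hx)) le_rfl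
    have hv' : WalkIn K (S : Set G.V) r (c b) v :=
      (hv.change_graph (K := K) fun x hx y hy hxy =>
        ⟨hxy, b, b, hB' (a, b) hx, hB' (a, b) hy, Or.inl rfl⟩).mono
          (fun x hx => hBS (a, b) x (Finset.mem_union_right _ hx)) le_rfl
    have huv' : K.Adj u v :=
      ⟨huv, a, b, hB (a, b) hu.right_mem, hB' (a, b) hv.right_mem, Or.inr hab⟩
    refine WalkIn.exists_walk_induce (A := (S : Set G.V)) (WalkIn.mono
      ((hu'.trans (.of_adj huv' hu'.right_mem hv'.right_mem)).trans hv'.symm) subset_rfl ?_)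
    omega

/-- If the subgraphs of members of a class have sparse neighborhood covers, then the class is
nowhere dense. -/
lemma nowhereDense_of_exists_sparse_covers {C : Set FGraph} {c : ℕ}
    (hc : ∀ (r : ℕ) (ε : ℝ), 0 < ε → ∃ d : ℝ, ∀ H : FGraph, (∃ G ∈ C, IsSubgraphOf H G) →
      ∃ X : Set (Set H.V), IsNbhdCover H.G r (c * r) X ∧
        ∀ v : H.V, (({Y ∈ X | v ∈ Y}).ncard : ℝ) ≤ d * (Fintype.card H.V : ℝ) ^ ε) :
    NowhereDense C := by
  intro r
  by_contra! hdense
  obtain ⟨L, hL⟩ : ∃ L, L = 2 * (c * (2 * r + 1)) + 1 := ⟨_, rfl⟩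
  have hL1 : 1 ≤ L := by omega
  have hL0 : (0 : ℝ) < L := by exact_mod_cast hL1
  obtain ⟨d, hd⟩ := hc (2 * r + 1) (1 / (4 * L)) (by positivity)
  set A : ℝ := ((2 * r + 3) * 4) ^ (1 / (4 * L : ℝ)) with hA
  have hA0 : 0 ≤ A := by positivity
  have hdA : 0 ≤ 4 * |d| * A := by positivity
  obtain ⟨D, hD⟩ := exists_nat_ge ((4 * |d| * A + 2) ^ 2)
  obtain ⟨N, hN⟩ : ∃ N, N = 2 * (D + 1) ^ L := ⟨_, rfl⟩
  obtain ⟨G, hG, hGN⟩ := hdense N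
  obtain ⟨F, hF, hFD⟩ := exists_highGirth (V := Fin N) (D := D) hL1 (by simp [hN])
  have hFG : IsDepthMinor r F G.G :=
    hGN.comap id Function.injective_id fun a b hab => by simpa using hab.ne
  obtain ⟨H, hH, hHcard, br, ctr, hmodel⟩ := hFG.exists_model
  obtain ⟨X, hX, hXd⟩ := hd H ⟨G, hG, hH⟩
  have hle := hmodel.adjPairs_le hF hL.ge hX hXd
  rw [Fintype.card_fin] at hle hFD hHcard
  have hNpos : (0 : ℝ) < N := by
    rw [hN]
    positivity
  have hDle : (D : ℝ) ≤ 4 * |d| * (Fintype.card H.V : ℝ) ^ (1 / (4 * L : ℝ)) := by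
    have h1 : (N * D : ℝ) ≤ 2 * adjPairs F Finset.univ := by exact_mod_cast hFD
    have h2 : (N * D : ℝ) ≤ N * (4 * (d * (Fintype.card H.V : ℝ) ^ (1 / (4 * L : ℝ)))) := by
      linarith
    have h3 := le_of_mul_le_mul_left h2 hNpos
    have h4 : d * (Fintype.card H.V : ℝ) ^ (1 / (4 * L : ℝ)) ≤
        |d| * (Fintype.card H.V : ℝ) ^ (1 / (4 * L : ℝ)) := by
      gcongr
      exact le_abs_self d
    linarith
  have hcard : (Fintype.card H.V : ℝ) ^ (1 / (4 * L : ℝ)) ≤ A * √(D + 1) := by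
    have h1 : (Fintype.card H.V : ℝ) ≤ (2 * r + 3) * 4 * ((D + 1 : ℝ) ^ (2 * L)) := by
      have h2 : (Fintype.card H.V : ℝ) ≤ (2 * r + 3) * (N * N) := by exact_mod_cast hHcard
      refine h2.trans_eq ?_
      rw [hN]
      push_cast
      ring
    calc (Fintype.card H.V : ℝ) ^ (1 / (4 * L : ℝ))
        ≤ ((2 * r + 3) * 4 * ((D + 1 : ℝ) ^ (2 * L))) ^ (1 / (4 * L : ℝ)) := by gcongr
      _ = A * ((D + 1 : ℝ) ^ (2 * L)) ^ (1 / (4 * L : ℝ)) :=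
          Real.mul_rpow (by positivity) (by positivity)
      _ = A * √(D + 1) := by
          rw [← Real.rpow_natCast, ← Real.rpow_mul (by positivity), Real.sqrt_eq_rpow]
          congr 2
          push_cast
          field_simp
          norm_num
  have hz : 4 * |d| * A + 2 ≤ √(D + 1) := Real.le_sqrt_of_sq_le (hD.trans (by linarith))
  have hz2 : √(D + 1 : ℝ) * √(D + 1) = D + 1 := Real.mul_self_sqrt (by positivity)
  have hfin : (D : ℝ) ≤ 4 * |d| * A * √(D + 1) := by
    calc (D : ℝ) ≤ 4 * |d| * (Fintype.card H.V : ℝ) ^ (1 / (4 * L : ℝ)) := hDle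
      _ ≤ 4 * |d| * (A * √(D + 1)) := by gcongr
      _ = _ := by ring
  nlinarith

end Backward

end SparseCovers

/-- A class `𝒞` is nowhere dense iff the class of subgraphs of its
members admits sparse neighborhood covers. -/
theorem stmt6 (C : Set FGraph) :
    NowhereDense C ↔
      ∃ c : ℕ, ∀ (r : ℕ) (ε : ℝ), 0 < ε → ∃ d : ℝ,
        ∀ H : FGraph, (∃ G ∈ C, IsSubgraphOf H G) →
          ∃ X : Set (Set H.V), IsNbhdCover H.G r (c * r) X ∧
            ∀ v : H.V, (({Y ∈ X | v ∈ Y}).ncard : ℝ) ≤ d * (Fintype.card H.V : ℝ) ^ ε := by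
  constructor
  · exact fun h => ⟨2, fun r ε hε => SparseCovers.exists_sparse_covers_of_nowhereDense h r hε⟩
  · rintro ⟨c, hc⟩
    exact SparseCovers.nowhereDense_of_exists_sparse_covers hc
end

section
/- For every graph G, the treedepth of G is equal to the minimum, over all linear orders π of V(G), of the maximum over all vertices v of the number of vertices weakly reachable from v with respect to π. -/
open SimpleGraph

variable {V : Type} {W : Type}

/-- A walk that starts at a descendant of `u` in a forest order `F` and stays above `u` in a
linear extension of `F` ends at a descendant of `u`. -/
theorem IsForestOrder.le_of_walk {V : Type} {G : SimpleGraph V} {F le : V → V → Prop}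
    [Std.Antisymm le] (hF : IsForestOrder F) (hG : ∀ u v, G.Adj u v → F u v ∨ F v u)
    (hle : ∀ u v, F u v → le u v) {u a v : V} (p : G.Walk a v) (ha : F u a)
    (hp : ∀ x ∈ p.support, le u x) : F u v := by
  obtain ⟨hrefl, htrans, -, hchain⟩ := hF
  induction p with
  | nil => exact ha
  | @cons a b v hab p ih =>
    have hp' : ∀ x ∈ p.support, le u x := fun x hx => hp x (by simp [hx])
    refine ih ?_ hp'
    rcases hG a b hab with h | h
    · exact htrans _ _ _ ha h
    · rcases hchain _ _ _ ha h with h | h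
      · exact h
      · obtain rfl : u = b := antisymm_of le (hp' _ p.start_mem_support) (hle _ _ h)
        exact hrefl _

theorem mem_WReachInf_iff {V : Type} {G : SimpleGraph V} {le : V → V → Prop} [Std.Refl le]
    {u v : V} : u ∈ WReachInf G le v ↔ ∃ p : G.Walk u v, ∀ x ∈ p.support, le u x := by
  classical
  constructor
  · rintro ⟨huv, p, -, hp⟩
    refine ⟨p, fun x hx => ?_⟩
    by_cases hxu : x = u
    · exact hxu ▸ refl_of le x
    by_cases hxv : x = v
    · exact hxv ▸ huv
    exact (hp x hx hxu hxv).1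
  · rintro ⟨p, hp⟩
    exact ⟨hp _ p.end_mem_support, p.bypass, p.bypass_isPath, fun x hx hxu _ =>
      ⟨hp x (p.support_bypass_subset_support hx), Ne.symm hxu⟩⟩

/-- Weak reachability with respect to a linear order is a forest order. -/
theorem isForestOrder_WReachInf {V : Type} (G : SimpleGraph V) (le : V → V → Prop)
    [IsLinearOrder V le] : IsForestOrder fun u v => u ∈ WReachInf G le v := by
  have chain {u v w : V} (huw : le u w) (hu : u ∈ WReachInf G le v)
      (hw : w ∈ WReachInf G le v) : u ∈ WReachInf G le w := by
    rw [mem_WReachInf_iff] at *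
    obtain ⟨p, hp⟩ := hu
    obtain ⟨q, hq⟩ := hw
    refine ⟨p.append q.reverse, fun x hx => ?_⟩
    rw [Walk.mem_support_append_iff, Walk.support_reverse, List.mem_reverse] at hx
    exact hx.elim (hp x) fun h => trans_of le huw (hq x h)
  refine ⟨fun v => mem_WReachInf_iff.2 ⟨Walk.nil, by simp [refl_of le]⟩, fun u v w hu hv => ?_,
    fun u v hu hv => antisymm_of le hu.1 hv.1, fun v u w hu hw => ?_⟩
  · have huv := hu.1
    simp only [mem_WReachInf_iff] at hu hv ⊢
    obtain ⟨p, hp⟩ := hu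
    obtain ⟨q, hq⟩ := hv
    refine ⟨p.append q, fun x hx => ?_⟩
    rw [Walk.mem_support_append_iff] at hx
    exact hx.elim (hp x) fun h => trans_of le huv (hq x h)
  · exact (total_of le u w).imp (chain · hu hw) (chain · hw hu)

theorem treedepthLE_iff {V : Type} [Finite V] (G : SimpleGraph V) (k : ℕ) :
    TreedepthLE G k ↔
      ∃ le : V → V → Prop, IsLinearOrder V le ∧ ∀ v, (WReachInf G le v).ncard ≤ k := by
  constructor
  · rintro ⟨F, hF, hG, hk⟩
    have : IsPartialOrder V F :=
      { refl := hF.1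
        trans := hF.2.1
        antisymm := hF.2.2.1 }
    obtain ⟨le, hlin, hle⟩ := extend_partialOrder F
    refine ⟨le, hlin, fun v => (Set.ncard_le_ncard (fun u hu => ?_)).trans (hk v)⟩
    obtain ⟨p, hp⟩ := mem_WReachInf_iff.1 hu
    exact hF.le_of_walk hG hle p (hF.1 u) hp
  · rintro ⟨le, hlin, hk⟩
    have edge {u v : V} (h : G.Adj u v) (huv : le u v) : u ∈ WReachInf G le v :=
      mem_WReachInf_iff.2 ⟨h.toWalk, by simp [huv, refl_of le]⟩
    exact ⟨_, isForestOrder_WReachInf G le,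
      fun u v h => (total_of le u v).imp (edge h) (edge h.symm), hk⟩

/-- The treedepth of `G` equals the minimum over linear orders of the
maximum number of weakly reachable vertices. -/
theorem stmt7 {V : Type} [Fintype V] (G : SimpleGraph V) :
    treedepth G =
      sInf {k | ∃ le : V → V → Prop, IsLinearOrder V le ∧
        ∀ v, (WReachInf G le v).ncard ≤ k} := by
  simp only [treedepth, treedepthLE_iff]
end

section
/- Let G be a graph, π a linear order of V(G), r ∈ ℕ, and let u, v ∈ V(G) with u <_π v and u ∉ WReach_r[G,π,v]. Then every path of length at most r connecting u and v contains a vertex of WReach_r[G,π,v] ∩ WReach_r[G,π,u]. -/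
open SimpleGraph

variable {V : Type} {W : Type}

/-- A nonempty list has a least element for any linear order relation. -/
theorem exists_least_mem_list {α : Type*} {le : α → α → Prop} (hle : IsLinearOrder α le) :
    ∀ l : List α, l ≠ [] → ∃ m ∈ l, ∀ x ∈ l, le m x
  | [], h => absurd rfl h
  | [a], _ => ⟨a, by simp, by simpa using hle.refl a⟩
  | a :: b :: l, _ => by
    obtain ⟨m, hm, hmin⟩ := exists_least_mem_list hle (b :: l) (by simp)
    rcases hle.total a m with h | h
    · exact ⟨a, by simp, List.forall_mem_cons.2
        ⟨hle.refl a, fun x hx => hle.trans _ _ _ h (hmin x hx)⟩⟩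
    · exact ⟨m, List.mem_cons_of_mem _ hm, List.forall_mem_cons.2 ⟨h, hmin⟩⟩

/-- The start of a short path is weakly reachable from its end if it is least on the path. -/
theorem mem_WReach_of_least {V : Type} {G : SimpleGraph V} {le : V → V → Prop} {r : ℕ} {m v : V}
    (p : G.Walk m v) (hp : p.IsPath) (hlen : p.length ≤ r) (hmin : ∀ x ∈ p.support, le m x) :
    m ∈ WReach G le r v :=
  ⟨hmin v p.end_mem_support, p, hp, hlen, fun x hx hxm _ => ⟨hmin x hx, hxm.symm⟩⟩

/-- If `u <_π v` and `u ∉ WReach_r[G,π,v]`, then every path of length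
at most `r` from `u` to `v` meets `WReach_r[G,π,v] ∩ WReach_r[G,π,u]`. -/
theorem stmt8 {V : Type} (G : SimpleGraph V) (le : V → V → Prop)
    (hle : IsLinearOrder V le) (r : ℕ) (u v : V)
    (huv : le u v) (hne : u ≠ v) (hnw : u ∉ WReach G le r v)
    (p : G.Walk u v) (hp : p.IsPath) (hlen : p.length ≤ r) :
    ∃ x ∈ p.support, x ∈ WReach G le r v ∩ WReach G le r u := by
  classical
  obtain ⟨m, hm, hmin⟩ := exists_least_mem_list hle p.support p.support_ne_nil
  refine ⟨m, hm, mem_WReach_of_least (p.dropUntil m hm) (hp.dropUntil hm)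
    ((p.length_dropUntil_le_length hm).trans hlen)
    fun x hx => hmin x (p.support_dropUntil_subset_support hm hx),
    mem_WReach_of_least (p.takeUntil m hm).reverse (hp.takeUntil hm).reverse ?_ fun x hx => ?_⟩
  · rw [Walk.length_reverse]
    exact (p.length_takeUntil_le_length hm).trans hlen
  · rw [Walk.support_reverse, List.mem_reverse] at hx
    exact hmin x (p.support_takeUntil_subset_support hm hx)
end
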